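/- arXiv:2206.04549 — 4 statements merged into one kernel-verified Lean document; each statement's English description precedes it below -/
import Mathlib

section
/- There exists an absolute constant C > 0 such that for all positive integers n and m and all sets S_1, …, S_m ⊆ {1,…,n}, there exists a vector x ∈ {−1,+1}^n such that max_{i∈[m]} |Σ_{j∈S_i} x_j| ≤ C·√(n·log(m/n + 2)). -/
open Finset in
lemma sp_ball {α : Type*} [Fintype α] [DecidableEq α] (x0 : α → Bool) :
    ((univ.filter (fun x : α → Bool => 16 * (univ.filter (fun j => x j ≠ x0 j)).card
      < Fintype.card α)).card : ℝ) ≤ (13/10 : ℝ) ^ Fintype.card α := by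
  set β : ℝ := 114/100 with hβ
  have hβ1 : (1:ℝ) ≤ β := by norm_num [hβ]
  have hβ0 : (0:ℝ) < β := by positivity
  have key : ∑ x : α → Bool, ∏ j, (if x j ≠ x0 j then (β^16)⁻¹ else 1)
      = (1 + (β^16)⁻¹) ^ Fintype.card α := by
    have := (Finset.prod_univ_sum (fun _ : α => (univ : Finset Bool))
      (fun j b => (if b ≠ x0 j then (β^16)⁻¹ else 1)))
    rw [Fintype.piFinset_univ] at this
    rw [← this]
    rw [Finset.prod_congr rfl (g := fun _ => (1 + (β^16)⁻¹))]
    · simp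
    · intro j _
      cases h : x0 j <;> simp [add_comm]
  have h2 : ∀ x : α → Bool, ∏ j, (if x j ≠ x0 j then (β^16)⁻¹ else 1)
      = ((β^16)⁻¹) ^ (univ.filter (fun j => x j ≠ x0 j)).card := by
    intro x
    rw [Finset.prod_ite]; simp
  have h3 : ((univ.filter (fun x : α → Bool => 16 * (univ.filter (fun j => x j ≠ x0 j)).card
      < Fintype.card α)).card : ℝ) ≤ β ^ Fintype.card α * (1 + (β^16)⁻¹) ^ Fintype.card α := by
    rw [← key, Finset.mul_sum, Finset.card_eq_sum_ones]
    push_cast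
    calc _ ≤ ∑ x ∈ (univ.filter (fun x : α → Bool => 16 * (univ.filter (fun j => x j ≠ x0 j)).card
      < Fintype.card α)), β ^ Fintype.card α * ∏ j, (if x j ≠ x0 j then (β^16)⁻¹ else 1) := by
            apply Finset.sum_le_sum
            intro x hx
            rw [h2 x, inv_pow, ← pow_mul, ← div_eq_mul_inv, one_le_div (by positivity)]
            apply pow_le_pow_right₀ hβ1
            exact (Finset.mem_filter.1 hx).2.le
      _ ≤ _ := by
            apply Finset.sum_le_sum_of_subset_of_nonneg (Finset.filter_subset _ _)
            intro x _ _
            rw [h2]; positivity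
  refine h3.trans ?_
  rw [← mul_pow]
  apply pow_le_pow_left₀ (by positivity)
  norm_num [hβ]

noncomputable def spCost (G : ℝ) (z : ℤ) : ℝ := if z = 0 then 0 else G + |(z:ℝ)|

lemma spCost_sum (G : ℝ) (R : ℕ) :
    ∑ z ∈ Finset.Icc (-(R:ℤ)) R, Real.exp (-spCost G z) ≤ 1 + 2 * Real.exp (-G) := by
  have hr : Real.exp (-1) ≤ 1/2 := by
    rw [Real.exp_neg, inv_le_comm₀ (Real.exp_pos _) (by norm_num)]
    have := Real.exp_one_gt_d9
    norm_num at *; linarith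
  have h : ∑ z ∈ Finset.Icc (-(R:ℤ)) R, Real.exp (-spCost G z)
      ≤ 1 + 2 * Real.exp (-G) * (1 - (1/2)^R) := by
    induction R with
    | zero => simp [spCost]
    | succ R ih =>
      have e : Finset.Icc (-((R+1:ℕ):ℤ)) ((R+1:ℕ):ℤ)
          = insert (-((R:ℤ)+1)) (insert ((R:ℤ)+1) (Finset.Icc (-(R:ℤ)) R)) := by
        ext z; simp only [Finset.mem_Icc, Finset.mem_insert]; push_cast; omega
      rw [e, Finset.sum_insert, Finset.sum_insert]
      · have hb : Real.exp (-(G + ((R:ℝ)+1))) ≤ Real.exp (-G) * (1/2)^(R+1) := by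
          rw [neg_add, Real.exp_add]
          gcongr
          have : -((R:ℝ)+1) = ((R+1:ℕ):ℝ) * (-1) := by push_cast; ring
          rw [this, Real.exp_nat_mul]
          gcongr
        have c1 : spCost G ((R:ℤ)+1) = G + ((R:ℝ)+1) := by
          unfold spCost
          rw [if_neg (by omega)]; push_cast; rw [abs_of_nonneg (by positivity)]
        have c2 : spCost G (-((R:ℤ)+1)) = G + ((R:ℝ)+1) := by
          unfold spCost
          rw [if_neg (by omega)]; push_cast; rw [abs_neg, abs_of_nonneg (by positivity)]
        rw [c1, c2]
        have : (1/2:ℝ)^(R+1) = (1/2)^R * (1/2) := pow_succ _ _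
        rw [this] at hb ⊢
        nlinarith
      · simp
      · simp only [Finset.mem_Icc, Finset.mem_insert]; omega
  refine h.trans ?_
  have : (0:ℝ) ≤ (1/2)^R := by positivity
  nlinarith [Real.exp_pos (-G)]

def spSgn (b : Bool) : ℝ := if b then 1 else -1

open Finset in
lemma sp_moment1 {α : Type*} [Fintype α] [DecidableEq α] (a : α → ℝ) (ha : ∀ j, |a j| ≤ 1) (θ : ℝ) :
    ∑ x : α → Bool, Real.exp (θ * ∑ j, a j * spSgn (x j))
      ≤ 2 ^ Fintype.card α * Real.exp (θ^2 * Fintype.card α / 2) := by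
  have := (Finset.prod_univ_sum (fun _ : α => (univ : Finset Bool))
      (fun j b => Real.exp (θ * (a j * spSgn b))))
  rw [Fintype.piFinset_univ] at this
  simp_rw [Finset.mul_sum, Real.exp_sum]
  rw [← this]
  have h2 : ∀ j ∈ (univ : Finset α), ∑ b : Bool, Real.exp (θ * (a j * spSgn b))
      ≤ 2 * Real.exp (θ^2/2) := by
    intro j _
    have h := Real.cosh_le_exp_half_sq (θ * a j)
    rw [Real.cosh_eq] at h
    have h3 : Real.exp ((θ * a j)^2/2) ≤ Real.exp (θ^2/2) := by
      apply Real.exp_le_exp.2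
      have : (a j)^2 ≤ 1 := by rw [sq_le_one_iff_abs_le_one]; exact ha j
      nlinarith [sq_nonneg θ, mul_pow θ (a j) 2]
    simp [spSgn]
    linarith
  refine (Finset.prod_le_prod (fun j _ => by positivity) h2).trans ?_
  rw [Finset.prod_const, mul_pow, ← Real.exp_nat_mul, Finset.card_univ]
  apply le_of_eq; congr 2; ring

open Finset in
lemma sp_moment {α : Type*} [Fintype α] [DecidableEq α] (a : α → ℝ) (ha : ∀ j, |a j| ≤ 1) (θ : ℝ) :
    ∑ x : α → Bool, Real.exp (θ * |∑ j, a j * spSgn (x j)|)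
      ≤ 2 * (2 ^ Fintype.card α * Real.exp (θ^2 * Fintype.card α / 2)) := by
  have h1 := sp_moment1 a ha θ
  have h2 := sp_moment1 a ha (-θ)
  rw [neg_sq] at h2
  calc _ ≤ ∑ x : α → Bool, (Real.exp (θ * ∑ j, a j * spSgn (x j))
            + Real.exp (-θ * ∑ j, a j * spSgn (x j))) := by
        apply Finset.sum_le_sum
        intro x _
        rcases abs_choice (∑ j, a j * spSgn (x j)) with h | h <;> rw [h]
        · linarith [Real.exp_pos (-θ * ∑ j, a j * spSgn (x j))]
        · rw [mul_neg, ← neg_mul]; linarith [Real.exp_pos (θ * ∑ j, a j * spSgn (x j))]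
    _ ≤ _ := by rw [Finset.sum_add_distrib]; linarith

lemma spCost_bound (L u : ℝ) (hL : 2 ≤ L) :
    spCost (L + 6) (round u) ≤ Real.exp (-(3/2*L+6)) * Real.exp (18 * L * |u|) := by
  unfold spCost
  split_ifs with h
  · positivity
  · have h1 : (1:ℝ) ≤ |(round u : ℝ)| := by
      rw [← Int.cast_abs]; exact_mod_cast Int.one_le_abs h
    have h2 := abs_sub_round u
    have h3 : |(round u : ℝ)| ≤ |u| + 1/2 := by
      have := abs_sub_abs_le_abs_sub (round u : ℝ) u
      rw [abs_sub_comm] at this; linarith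
    set B := |(round u : ℝ)|
    rw [← Real.exp_add]
    have h4 : L + 6 + B ≤ 9/2 * (L * B) := by nlinarith
    have h5 : 9/2 * (L*B) ≤ -(3/2*L+6) + 18 * L * |u| := by nlinarith
    have := Real.add_one_le_exp (-(3/2*L+6) + 18 * L * |u|)
    linarith

open Finset in
lemma sp_pigeon {α : Type*} [Fintype α] [DecidableEq α] [Nonempty α] (m : ℕ)
    (b : (α → Bool) → Fin m → ℤ) (G : ℝ) (hG : 0 ≤ G)
    (h1 : ∑ x, ∑ i, spCost G (b x i) ≤ 2 ^ Fintype.card α * (Fintype.card α / 1000))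
    (h2 : 2 * m * Real.exp (-G) ≤ Fintype.card α / 1000) :
    ∃ x x', b x = b x' ∧ Fintype.card α ≤ 16 * (univ.filter (fun j => x j ≠ x' j)).card := by
  set k := Fintype.card α with hk
  have hk0 : 0 < k := Fintype.card_pos
  have hkR : (0:ℝ) < k := by exact_mod_cast hk0
  have hc0 : ∀ z, 0 ≤ spCost G z := by
    intro z; unfold spCost; split_ifs <;> positivity
  set F : (α → Bool) → ℝ := fun x => ∑ i, spCost G (b x i) with hF
  have hF0 : ∀ x, 0 ≤ F x := fun x => Finset.sum_nonneg (fun i _ => hc0 _)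
  set K : ℝ := 4 * (k/1000) with hK
  have hK0 : 0 < K := by positivity
  set good := univ.filter (fun x => F x ≤ K) with hgood
  have hgc : (3/4:ℝ) * 2^k ≤ good.card := by
    have hb : ((univ.filter (fun x => ¬ F x ≤ K)).card : ℝ) * K ≤ 2^k * (k/1000) := by
      calc _ = ∑ x ∈ univ.filter (fun x => ¬ F x ≤ K), K := by simp
        _ ≤ ∑ x ∈ univ.filter (fun x => ¬ F x ≤ K), F x := by
            apply Finset.sum_le_sum; intro x hx
            exact (not_le.1 (Finset.mem_filter.1 hx).2).le
        _ ≤ ∑ x, F x := Finset.sum_le_sum_of_subset_of_nonneg (Finset.filter_subset _ _)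
              (fun x _ _ => hF0 x)
        _ ≤ _ := h1
    have hb2 : ((univ.filter (fun x => ¬ F x ≤ K)).card : ℝ) ≤ 2^k / 4 := by
      rw [hK] at hb
      have hk4 : (0:ℝ) < k/1000 := by positivity
      have : ((univ.filter (fun x => ¬ F x ≤ K)).card : ℝ) * 4 ≤ 2^k := by
        apply le_of_mul_le_mul_right _ hk4
        linarith
      linarith
    have hs := Finset.card_filter_add_card_filter_not (s := (univ : Finset (α → Bool))) (fun x => F x ≤ K)
    have hs' : (good.card : ℝ) + ((univ.filter (fun x => ¬ F x ≤ K)).card : ℝ) = 2^k := by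
      rw [hgood]; 
      have : (univ : Finset (α → Bool)).card = 2^k := by simp [hk]
      rw [this] at hs
      exact_mod_cast hs
    linarith
  -- count of classes
  set I := good.image b with hI
  obtain ⟨R, hR⟩ : ∃ R : ℕ, ∀ x i, b x i ∈ Finset.Icc (-(R:ℤ)) R := by
    refine ⟨∑ x, ∑ i, (b x i).natAbs, fun x i => ?_⟩
    have h3 : (b x i).natAbs ≤ ∑ x, ∑ i, (b x i).natAbs :=
      (Finset.single_le_sum (f := fun i => (b x i).natAbs) (fun _ _ => Nat.zero_le _)
        (Finset.mem_univ i)).trans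
      (Finset.single_le_sum (f := fun x => ∑ i, (b x i).natAbs) (fun _ _ => Nat.zero_le _)
        (Finset.mem_univ x))
    rw [Finset.mem_Icc]; omega
  have hIc : (I.card : ℝ) ≤ Real.exp (5 * (k/1000)) := by
    calc (I.card : ℝ) = ∑ y ∈ I, (1:ℝ) := by simp
      _ ≤ ∑ y ∈ I, Real.exp K * ∏ i, Real.exp (-spCost G (y i)) := by
          apply Finset.sum_le_sum; intro y hy
          obtain ⟨x, hx, rfl⟩ := Finset.mem_image.1 hy
          have hx' : ∑ i, spCost G (b x i) ≤ K := (Finset.mem_filter.1 hx).2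
          rw [← Real.exp_sum, ← Real.exp_add, Finset.sum_neg_distrib]
          apply Real.one_le_exp
          linarith
      _ ≤ ∑ y ∈ Fintype.piFinset (fun _ : Fin m => Finset.Icc (-(R:ℤ)) R),
            Real.exp K * ∏ i, Real.exp (-spCost G (y i)) := by
          apply Finset.sum_le_sum_of_subset_of_nonneg
          · intro y hy
            obtain ⟨x, hx, rfl⟩ := Finset.mem_image.1 hy
            exact Fintype.mem_piFinset.2 (hR x)
          · intros; positivity
      _ = Real.exp K * ∏ i : Fin m, ∑ z ∈ Finset.Icc (-(R:ℤ)) R, Real.exp (-spCost G z) := by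
          rw [← Finset.mul_sum, Finset.prod_univ_sum]
      _ ≤ Real.exp K * ∏ i : Fin m, Real.exp (2 * Real.exp (-G)) := by
          gcongr with i
          have := Real.add_one_le_exp (2 * Real.exp (-G))
          linarith [spCost_sum G R]
      _ ≤ _ := by
          rw [Finset.prod_const, ← Real.exp_nat_mul, ← Real.exp_add]
          apply Real.exp_le_exp.2
          simp only [Finset.card_univ, Fintype.card_fin]
          linarith
  have hlt : I.card • ((13/10:ℝ)^k) < good.card := by
    rw [nsmul_eq_mul]
    have e1 : Real.exp (5 * (k/1000)) = (Real.exp (1/200))^k := by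
      rw [← Real.exp_nat_mul]; congr 1; ring
    have e2 : Real.exp (1/200) < 11/10 := by
      have h := Real.exp_bound_div_one_sub_of_interval (x := 1/200) (by norm_num) (by norm_num)
      norm_num at h ⊢; linarith
    calc _ ≤ (Real.exp (1/200))^k * (13/10:ℝ)^k := by rw [← e1]; gcongr
      _ = (Real.exp (1/200) * (13/10))^k := by rw [mul_pow]
      _ < (3/4 * 2)^k := by
          apply pow_lt_pow_left₀ _ (by positivity) hk0.ne'
          linarith
      _ = (3/4)^k * 2^k := by rw [mul_pow]
      _ ≤ 3/4 * 2^k := by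
          gcongr
          calc (3/4:ℝ)^k ≤ (3/4)^1 := pow_le_pow_of_le_one (by norm_num) (by norm_num) hk0
            _ = 3/4 := by simp
      _ ≤ _ := hgc
  obtain ⟨y, hy, hy2⟩ := Finset.exists_lt_card_fiber_of_nsmul_lt_card_of_maps_to
    (s := good) (t := I) (f := b) (fun x hx => Finset.mem_image_of_mem b hx) hlt
  obtain ⟨x0, hx0⟩ : (good.filter (fun x => b x = y)).Nonempty := by
    rw [← Finset.card_pos]
    have : (0:ℝ) < (good.filter (fun x => b x = y)).card := lt_trans (by positivity) hy2
    exact_mod_cast this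
  by_contra hcon
  push Not at hcon
  have hsub : (good.filter (fun x => b x = y)) ⊆
      (univ.filter (fun x : α → Bool => 16 * (univ.filter (fun j => x j ≠ x0 j)).card
      < Fintype.card α)) := by
    intro x hx
    rw [Finset.mem_filter]
    exact ⟨Finset.mem_univ _, hcon x x0 ((Finset.mem_filter.1 hx).2.trans (Finset.mem_filter.1 hx0).2.symm)⟩
  have hcc : ((good.filter (fun x => b x = y)).card : ℝ) ≤ (13/10:ℝ)^k :=
    le_trans (by exact_mod_cast Finset.card_le_card hsub) (sp_ball x0)
  linarith

open Finset in
lemma sp_partial {α : Type} [Fintype α] [DecidableEq α] [Nonempty α] (m : ℕ)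
    (a : Fin m → α → ℝ) (ha : ∀ i j, |a i j| ≤ 1) (M : ℝ) (hM1 : (Fintype.card α : ℝ) ≤ M)
    (hM2 : (m : ℝ) ≤ M) :
    ∃ y : α → ℝ, (∀ j, y j = 1 ∨ y j = -1 ∨ y j = 0) ∧
      Fintype.card α ≤ 16 * (univ.filter (fun j => y j ≠ 0)).card ∧
      ∀ i, |∑ j, a i j * y j| ≤
        18 * Real.sqrt (Fintype.card α * (2 + Real.log (M / Fintype.card α))) := by
  set k := Fintype.card α with hk
  have hk0 : 0 < k := Fintype.card_pos
  have hkR : (0:ℝ) < k := by exact_mod_cast hk0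
  have hM0 : 0 < M := lt_of_lt_of_le hkR hM1
  set L := 2 + Real.log (M / k) with hLdef
  have hL : 2 ≤ L := by
    have : 0 ≤ Real.log (M/k) := Real.log_nonneg (by rwa [one_le_div hkR])
    linarith
  have hexpL : Real.exp (-L) = Real.exp (-2) * (k / M) := by
    rw [hLdef, neg_add, Real.exp_add, Real.exp_neg (Real.log _), Real.exp_log (by positivity), inv_div]
  have he8 : Real.exp (-8) ≤ 1/2000 := by
    have h1 : Real.exp 8 = (Real.exp 1)^8 := by rw [← Real.exp_nat_mul]; norm_num
    have h2 : (2.7:ℝ)^8 ≤ (Real.exp 1)^8 := by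
      have := Real.exp_one_gt_d9
      gcongr; linarith
    rw [Real.exp_neg, inv_le_comm₀ (Real.exp_pos _) (by norm_num), h1]
    refine le_trans ?_ h2
    norm_num
  have he8k : Real.exp (-L - 6) * M ≤ k / 2000 := by
    have : Real.exp (-L - 6) = Real.exp (-8) * (k/M) := by
      rw [sub_eq_add_neg, Real.exp_add, hexpL, mul_right_comm, ← Real.exp_add]; norm_num
    rw [this, mul_assoc, div_mul_cancel₀ _ hM0.ne']
    nlinarith
  have he8m : Real.exp (-L - 6) * m ≤ k / 2000 :=
    le_trans (by gcongr) he8k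
  set W := 18 * Real.sqrt (k * L) with hW
  have hW0 : 0 < W := by positivity
  set Y : (α → Bool) → Fin m → ℝ := fun x i => ∑ j, a i j * spSgn (x j) with hY
  set θ := Real.sqrt (k*L) / k with hθ
  have hθ2 : θ^2 * k = L := by
    rw [hθ, div_pow, Real.sq_sqrt (by positivity)]; field_simp
  have hθW : 18 * L = θ * W := by
    rw [hθ, hW]
    have := Real.mul_self_sqrt (show (0:ℝ) ≤ k*L by positivity)
    generalize Real.sqrt (k*L) = q at this
    rw [div_mul_eq_mul_div, eq_div_iff hkR.ne']
    linarith
  obtain ⟨x, x', hb, hd⟩ := sp_pigeon m (fun x i => round (Y x i / W)) (L+6) (by linarith) (by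
      rw [Finset.sum_comm]
      have hi : ∀ i ∈ (univ : Finset (Fin m)), ∑ x, spCost (L+6) (round (Y x i / W))
          ≤ 2 * 2^k * Real.exp (-L-6) := by
        intro i _
        calc _ ≤ ∑ x, Real.exp (-(3/2*L+6)) * Real.exp (θ * |Y x i|) := by
              apply Finset.sum_le_sum; intro x _
              refine (spCost_bound L _ hL).trans (le_of_eq ?_)
              rw [hθW, abs_div, abs_of_pos hW0]
              congr 2
              field_simp
          _ ≤ Real.exp (-(3/2*L+6)) * (2 * (2^k * Real.exp (θ^2 * k / 2))) := by
              rw [← Finset.mul_sum]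
              gcongr
              exact sp_moment (a i) (ha i) θ
          _ = _ := by
              rw [hθ2]
              have : Real.exp (-L-6) = Real.exp (-(3/2*L+6)) * Real.exp (L/2) := by
                rw [← Real.exp_add]; congr 1; ring
              rw [this]; ring
      refine (Finset.sum_le_sum hi).trans ?_
      rw [Finset.sum_const, nsmul_eq_mul, Finset.card_univ, Fintype.card_fin]
      have : (0:ℝ) < 2^k := by positivity
      have := mul_le_mul_of_nonneg_left he8m this.le
      linarith) (by
      have : -(L+6) = -L-6 := by ring
      rw [this]; linarith)
  refine ⟨fun j => (spSgn (x j) - spSgn (x' j))/2, ?_, ?_, ?_⟩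
  · intro j
    rcases hxj : x j <;> rcases hxj' : x' j <;> norm_num [spSgn, hxj, hxj']
  · convert hd using 6 with j
    rcases hxj : x j <;> rcases hxj' : x' j <;> norm_num [spSgn, hxj, hxj']
  · intro i
    have hbi : round (Y x i / W) = round (Y x' i / W) := congrFun hb i
    have e : ∑ j, a i j * ((spSgn (x j) - spSgn (x' j))/2) = (Y x i - Y x' i)/2 := by
      rw [hY, ← Finset.sum_sub_distrib, Finset.sum_div]
      apply Finset.sum_congr rfl; intros; ring
    rw [e]
    have h1 := abs_le.1 (abs_sub_round (Y x i / W))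
    have h2 := abs_le.1 (abs_sub_round (Y x' i / W))
    rw [hbi] at h1
    have h3 : |Y x i / W - Y x' i / W| ≤ 1 := abs_le.2 ⟨by linarith, by linarith⟩
    rw [← sub_div, abs_div, abs_of_pos hW0, div_le_one hW0] at h3
    rw [abs_div, abs_of_pos (by norm_num : (0:ℝ) < 2)]
    linarith [abs_nonneg (Y x i - Y x' i)]

lemma sp_decay (k k' M : ℝ) (hk' : 0 < k') (hkk : k' ≤ 15/16 * k) (hM : k ≤ M) :
    Real.sqrt (k' * (2 + Real.log (M / k'))) ≤ (63/64) * Real.sqrt (k * (2 + Real.log (M / k))) := by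
  have hk : 0 < k := by linarith
  have hM0 : 0 < M := by linarith
  have hl0 : 0 ≤ Real.log (M/k) := Real.log_nonneg (by rwa [one_le_div hk])
  have e : Real.log (M/k') = Real.log (M/k) + Real.log (k/k') := by
    rw [← Real.log_mul (by positivity) (by positivity)]; congr 1; field_simp
  have h1 : k' * Real.log (k/k') ≤ k - k' := by
    have := Real.log_le_sub_one_of_pos (show 0 < k/k' by positivity)
    calc _ ≤ k' * (k/k' - 1) := by gcongr
      _ = _ := by field_simp
  have h2 : k' * (2 + Real.log (M / k')) ≤ (63/64)^2 * (k * (2 + Real.log (M / k))) := by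
    rw [e]
    nlinarith
  calc _ ≤ Real.sqrt ((63/64)^2 * (k * (2 + Real.log (M / k)))) := Real.sqrt_le_sqrt h2
    _ = _ := by rw [Real.sqrt_mul (by norm_num), Real.sqrt_sq (by norm_num)]

open Finset in
lemma sp_full (m : ℕ) (M : ℝ) (hM2 : (m : ℝ) ≤ M) (k : ℕ) : ∀ (α : Type) [Fintype α] [DecidableEq α],
    Fintype.card α = k → (k:ℝ) ≤ M → ∀ (a : Fin m → α → ℝ), (∀ i j, |a i j| ≤ 1) →
    ∃ x : α → ℝ, (∀ j, x j = 1 ∨ x j = -1) ∧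
      ∀ i, |∑ j, a i j * x j| ≤ 1152 * Real.sqrt (k * (2 + Real.log (M / k))) := by
  induction k using Nat.strong_induction_on with
  | _ k ih =>
  intro α _ _ hα hM a ha
  rcases isEmpty_or_nonempty α with hE | hE
  · exact ⟨fun _ => 1, fun j => hE.elim j, fun i => by rw [Finset.univ_eq_empty, Finset.sum_empty, abs_zero]; positivity⟩
  obtain ⟨y, hy1, hy2, hy3⟩ := sp_partial m a ha M (by rw [hα]; exact hM) hM2
  rw [hα] at hy2 hy3
  have hk0 : 0 < k := by rw [← hα]; exact Fintype.card_pos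
  set k' := Fintype.card {j // y j = 0} with hk'
  have hkk : k' + (univ.filter (fun j => y j ≠ 0)).card = k := by
    rw [hk', Fintype.card_subtype, ← hα, ← Finset.card_univ]
    exact Finset.card_filter_add_card_filter_not (s := (univ : Finset α)) (fun j => y j = 0)
  have hlt : k' < k := by omega
  have hkkR : (k':ℝ) ≤ 15/16 * k := by
    have : 16 * k' ≤ 15 * k := by omega
    have : (16:ℝ) * k' ≤ 15 * k := by exact_mod_cast this
    linarith
  obtain ⟨x, hx1, hx2⟩ := ih k' hlt {j // y j = 0} rfl
    (le_trans (by exact_mod_cast hlt.le) hM) (fun i j => a i j) (fun i j => ha i j)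
  refine ⟨fun j => if h : y j = 0 then x ⟨j, h⟩ else y j, ?_, ?_⟩
  · intro j
    by_cases h : y j = 0
    · simp only [h, dite_true]; exact hx1 _
    · simp only [h, dite_false]
      rcases hy1 j with h' | h' | h'
      · exact Or.inl h'
      · exact Or.inr h'
      · exact absurd h' h
  · intro i
    have e : ∑ j, a i j * (if h : y j = 0 then x ⟨j, h⟩ else y j)
        = ∑ j, a i j * y j + ∑ j : {j // y j = 0}, a i j * x j := by
      have e1 : ∑ j : {j // y j = 0}, a i j * x j
          = ∑ j, (if h : y j = 0 then a i j * x ⟨j, h⟩ else 0) := by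
        rw [← Fintype.sum_subtype_add_sum_subtype (fun j => y j = 0)
          (fun j => (if h : y j = 0 then a i j * x ⟨j, h⟩ else 0))]
        rw [Finset.sum_eq_zero (s := (univ : Finset {j // ¬ y j = 0})) (fun j _ => by rw [dif_neg j.2]),
          add_zero]
        apply Finset.sum_congr rfl
        intro j _
        rw [dif_pos j.2]
      rw [e1, ← Finset.sum_add_distrib]
      apply Finset.sum_congr rfl
      intro j _
      by_cases h : y j = 0 <;> simp [h]
    rw [e]
    have hx := hx2 i
    have hy := hy3 i
    have ht := abs_add_le (∑ j, a i j * y j) (∑ j : {j // y j = 0}, a i j * x j)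
    have hd : Real.sqrt (k' * (2 + Real.log (M / k'))) ≤
        (63/64) * Real.sqrt (k * (2 + Real.log (M / k))) := by
      rcases Nat.eq_zero_or_pos k' with h | h
      · rw [h, Nat.cast_zero, zero_mul, Real.sqrt_zero]; positivity
      · exact sp_decay k k' M (by exact_mod_cast h) hkkR hM
    linarith

/-- Spencer's theorem: there is an absolute constant `C > 0` such that for every set system
`S_1, …, S_m ⊆ [n]` there is a `±1` coloring `x` with
`max_i |∑_{j ∈ S_i} x_j| ≤ C √(n log(m/n + 2))`. -/
theorem spencer_six_standard_deviations :
    ∃ C : ℝ, 0 < C ∧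
      ∀ (n m : ℕ), 0 < n → 0 < m →
        ∀ S : Fin m → Finset (Fin n),
          ∃ x : Fin n → ℝ, (∀ j, x j = 1 ∨ x j = -1) ∧
            ∀ i, |∑ j ∈ S i, x j| ≤
              C * Real.sqrt ((n : ℝ) * Real.log ((m : ℝ) / (n : ℝ) + 2)) := by
  refine ⟨2304, by norm_num, ?_⟩
  intro n m hn hm S
  have hnR : (0:ℝ) < n := by exact_mod_cast hn
  have hmR : (0:ℝ) < m := by exact_mod_cast hm
  obtain ⟨x, hx1, hx2⟩ := sp_full m (max m n) (le_max_left _ _) n (Fin n) (Fintype.card_fin n)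
    (le_max_right _ _) (fun i j => if j ∈ S i then 1 else 0)
    (fun i j => by split_ifs <;> simp)
  refine ⟨x, hx1, fun i => ?_⟩
  have h := hx2 i
  simp only [ite_mul, one_mul, zero_mul, Finset.sum_ite_mem, Finset.univ_inter] at h
  refine h.trans ?_
  have hL2 : Real.log 2 ≤ Real.log ((m:ℝ)/n+2) := by
    apply Real.log_le_log (by norm_num)
    have : (0:ℝ) < m/n := by positivity
    linarith
  have hlog : Real.log (max (m:ℝ) n / n) ≤ Real.log ((m:ℝ)/n+2) := by
    apply Real.log_le_log
    · have : (0:ℝ) < max (m:ℝ) n := lt_max_of_lt_left hmR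
      positivity
    · rw [div_le_iff₀ hnR, add_mul, div_mul_cancel₀ _ hnR.ne']
      apply max_le <;> linarith
  have hle : (n:ℝ) * (2 + Real.log (max (m:ℝ) n / n)) ≤ 2^2 * (n * Real.log ((m:ℝ)/n+2)) := by
    have h2 := Real.log_two_gt_d9
    nlinarith
  have := Real.sqrt_le_sqrt hle
  rw [Real.sqrt_mul (by norm_num : (0:ℝ) ≤ 2^2), Real.sqrt_sq (by norm_num)] at this
  linarith
end

section
/- There exist absolute constants C₀ > 0, η > 0 and n₀ such that the following holds for all n ≥ n₀ and all positive integers m. Let A ∈ ℝ^{m×n} satisfy ‖A‖_{1→∞} ≤ 1, let ε = 1/log n, and sample independently g ~ N(0,I_n) and C_Alg uniformly from the interval [C₀, 2C₀]. Then with probability at least 4/5, every x ∈ Γ_{A,C_Alg} satisfying ⟨g,x⟩/√n ≥ sup_{y ∈ Γ_{A,C_Alg}} ⟨g,y⟩/√n − ε·η·√n has at least η·n coordinates j with |x_j| ≥ 1 − ε. -/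
open MeasureTheory ProbabilityTheory

/-- `Γ_{A,C} = {x : ‖x‖_∞ ≤ 1 ∧ ‖Ax‖_∞ ≤ C √(n log(m/n + 2))}`. -/
def Gamma (m n : ℕ) (A : Matrix (Fin m) (Fin n) ℝ) (C : ℝ) : Set (Fin n → ℝ) :=
  {x | (∀ j, |x j| ≤ 1) ∧
    ∀ i, |A.mulVec x i| ≤ C * Real.sqrt ((n : ℝ) * Real.log ((m : ℝ) / (n : ℝ) + 2))}

/-- The law of a standard Gaussian vector in `ℝⁿ`. -/
noncomputable def gaussianPi (n : ℕ) : Measure (Fin n → ℝ) :=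
  Measure.pi fun _ => gaussianReal 0 1

/-- The uniform probability measure on the interval `[a, b]`. -/
noncomputable def unifIcc (a b : ℝ) : Measure ℝ :=
  (volume (Set.Icc a b))⁻¹ • volume.restrict (Set.Icc a b)


theorem gs_conc : ∀ (n : ℕ) (f : (Fin n → Bool) → ℝ),
    (∀ x y, |f x - f y| ≤ hammingDist x y) → ∀ t : ℝ,
    ∑ x, Real.exp (t * f x) ≤ 2 ^ n * Real.exp (t * ((∑ x, f x) / 2 ^ n) + t ^ 2 * n / 2) := by
  intro n
  induction n with
  | zero => intro f _ t; simp
  | succ n ih =>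
    intro f hf t
    have key : ∀ h : (Fin (n+1) → Bool) → ℝ, ∑ x, h x
        = ∑ x : Fin n → Bool, h (Fin.cons false x) + ∑ x : Fin n → Bool, h (Fin.cons true x) := by
      intro h
      rw [← (Fin.consEquiv (fun _ : Fin (n+1) => Bool)).sum_comp, Fintype.sum_prod_type]
      simp [Fin.consEquiv, add_comm]
    have hd : ∀ (b : Bool) (x y : Fin n → Bool),
        hammingDist (Fin.cons b x : Fin (n+1) → Bool) (Fin.cons b y) = hammingDist x y := by
      intro b x y
      simp only [hammingDist, Finset.card_filter, Fin.sum_univ_succ]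
      simp
    have hd1 : ∀ (x : Fin n → Bool),
        hammingDist (Fin.cons false x : Fin (n+1) → Bool) (Fin.cons true x) = 1 := by
      intro x
      simp only [hammingDist, Finset.card_filter, Fin.sum_univ_succ]
      simp
    have i0 := ih (fun x => f (Fin.cons false x)) (fun x y => by
      have := hf (Fin.cons false x) (Fin.cons false y); rwa [hd] at this) t
    have i1 := ih (fun x => f (Fin.cons true x)) (fun x y => by
      have := hf (Fin.cons true x) (Fin.cons true y); rwa [hd] at this) t
    rw [key, key]
    set m0 := (∑ x : Fin n → Bool, f (Fin.cons false x)) / 2 ^ n with hm0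
    set m1 := (∑ x : Fin n → Bool, f (Fin.cons true x)) / 2 ^ n with hm1
    have hm : |m0 - m1| ≤ 1 := by
      rw [hm0, hm1, ← sub_div, ← Finset.sum_sub_distrib, abs_div, div_le_one (by positivity)]
      refine (Finset.abs_sum_le_sum_abs _ _).trans ?_
      refine (Finset.sum_le_sum (g := fun _ => (1:ℝ)) ?_).trans ?_
      · intro x _
        have := hf (Fin.cons false x) (Fin.cons true x)
        rw [hd1] at this; simpa using this
      · simp
    have e : (∑ x : Fin n → Bool, f (Fin.cons false x) + ∑ x : Fin n → Bool, f (Fin.cons true x)) / 2 ^ (n+1) = (m0 + m1) / 2 := by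
      rw [hm0, hm1]; field_simp; ring
    rw [e]
    have hc := Real.cosh_le_exp_half_sq (t * (m0 - m1) / 2)
    have hc2 : Real.exp ((t * (m0 - m1) / 2) ^ 2 / 2) ≤ Real.exp (t ^ 2 / 2) := by
      apply Real.exp_le_exp.2
      have : (m0 - m1) ^ 2 ≤ 1 := by rw [← sq_abs]; nlinarith [abs_nonneg (m0 - m1)]
      nlinarith [sq_nonneg t, mul_le_mul_of_nonneg_left this (sq_nonneg t)]
    rw [Real.cosh_eq] at hc
    have hs : Real.exp (t * m0) + Real.exp (t * m1)
        ≤ 2 * (Real.exp (t * ((m0 + m1) / 2)) * Real.exp (t ^ 2 / 2)) := by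
      have : Real.exp (t * m0) + Real.exp (t * m1) = Real.exp (t * ((m0 + m1) / 2)) *
          (Real.exp (t * (m0 - m1) / 2) + Real.exp (-(t * (m0 - m1) / 2))) := by
        rw [mul_add, ← Real.exp_add, ← Real.exp_add]; congr 2 <;> ring
      rw [this]
      have h3 := hc.trans hc2
      have := Real.exp_pos (t * ((m0 + m1) / 2))
      nlinarith
    rw [Real.exp_add] at i0 i1 ⊢
    have e3 : Real.exp (t ^ 2 * ((n + 1 : ℕ) : ℝ) / 2) = Real.exp (t ^ 2 * n / 2) * Real.exp (t ^ 2 / 2) := by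
      rw [← Real.exp_add]; congr 1; push_cast; ring
    rw [e3, pow_succ]
    have hp : 0 < (2:ℝ) ^ n * Real.exp (t ^ 2 * n / 2) := by positivity
    nlinarith [mul_le_mul_of_nonneg_left hs hp.le]

theorem gs_blow (n : ℕ) (S : Finset (Fin n → Bool)) (t r : ℝ) (ht : 0 ≤ t) :
    ((Finset.univ.filter (fun x : Fin n → Bool => ∀ s ∈ S, r < hammingDist x s)).card : ℝ) * S.card
      ≤ 4 ^ n * Real.exp (t ^ 2 * n - t * r) := by
  rcases S.eq_empty_or_nonempty with h | hS
  · subst h; simp; positivity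
  set f : (Fin n → Bool) → ℝ := fun x => ((S.inf' hS (fun s => hammingDist x s) : ℕ) : ℝ) with hfdef
  have hex : ∀ x, ∃ s ∈ S, f x = hammingDist x s := by
    intro x
    obtain ⟨s, hs, h⟩ := S.exists_mem_eq_inf' hS (fun s => hammingDist x s)
    exact ⟨s, hs, by simp only [hfdef]; rw [h]⟩
  have hle : ∀ x, ∀ s ∈ S, f x ≤ hammingDist x s := by
    intro x s hs
    simp only [hfdef]
    exact_mod_cast Finset.inf'_le (fun s => hammingDist x s) hs
  have h1 : ∀ x y, f x - f y ≤ hammingDist x y := by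
    intro x y
    obtain ⟨s, hs, h⟩ := hex y
    have a := hle x s hs
    have b : (hammingDist x s : ℝ) ≤ hammingDist x y + hammingDist y s := by
      exact_mod_cast hammingDist_triangle x y s
    linarith
  have hL : ∀ x y, |f x - f y| ≤ hammingDist x y := by
    intro x y
    rw [abs_le]
    have := h1 x y
    have h2 := h1 y x
    rw [hammingDist_comm] at h2
    constructor <;> linarith
  have cp := gs_conc n f hL t
  have cm := gs_conc n f hL (-t)
  have a1 : ((Finset.univ.filter (fun x : Fin n → Bool => ∀ s ∈ S, r < hammingDist x s)).card : ℝ) * Real.exp (t * r) ≤ ∑ x, Real.exp (t * f x) := by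
    rw [← nsmul_eq_mul, ← Finset.sum_const]
    refine (Finset.sum_le_sum (g := fun x => Real.exp (t * f x)) ?_).trans
      (Finset.sum_le_sum_of_subset_of_nonneg (Finset.subset_univ _) (fun _ _ _ => (Real.exp_pos _).le))
    intro x hx
    obtain ⟨s, hs, h⟩ := hex x
    have := (Finset.mem_filter.1 hx).2 s hs
    apply Real.exp_le_exp.2
    rw [h]; exact mul_le_mul_of_nonneg_left this.le ht
  have a2 : (S.card : ℝ) ≤ ∑ x, Real.exp (-t * f x) := by
    have : (S.card : ℝ) = ∑ x ∈ S, (1:ℝ) := by simp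
    rw [this]
    refine (Finset.sum_le_sum (g := fun x => Real.exp (-t * f x)) ?_).trans
      (Finset.sum_le_sum_of_subset_of_nonneg (Finset.subset_univ _) (fun _ _ _ => (Real.exp_pos _).le))
    intro x hx
    have h0 := hle x x hx
    have h0' : 0 ≤ f x := by simp only [hfdef]; positivity
    rw [hammingDist_self] at h0
    have : f x = 0 := le_antisymm (by simpa using h0) h0'
    simp [this]
  have := mul_le_mul (a1.trans cp) (a2.trans cm) (by positivity) (by positivity)
  have e : (2:ℝ) ^ n * Real.exp (t * ((∑ x, f x) / 2 ^ n) + t ^ 2 * n / 2) * (2 ^ n * Real.exp (-t * ((∑ x, f x) / 2 ^ n) + (-t) ^ 2 * n / 2)) = 4 ^ n * Real.exp (t ^ 2 * n) := by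
    rw [mul_mul_mul_comm, ← mul_pow, ← Real.exp_add]; norm_num; ring
  rw [e] at this
  rw [Real.exp_sub, mul_div_assoc', le_div_iff₀ (Real.exp_pos _)]
  linarith

/-- sign of a Boolean. -/
noncomputable def gsg (b : Bool) : ℝ := if b then 1 else -1

theorem gs_intsum (q : ℝ) (h0 : 0 ≤ q) (h1 : q ≤ 1/2) (T : Finset ℤ) :
    ∑ z ∈ T, q ^ z.natAbs ≤ 1 + 4 * q := by
  have ha : HasSum (fun n : ℕ => q ^ ((n:ℤ)).natAbs) (1 - q)⁻¹ := by
    simpa using hasSum_geometric_of_lt_one h0 (by linarith)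
  have hb : HasSum (fun n : ℕ => q ^ (-((n:ℤ) + 1)).natAbs) (q * (1 - q)⁻¹) := by
    have := (hasSum_geometric_of_lt_one h0 (by linarith)).mul_left q
    have e : (fun n : ℕ => q ^ (-((n:ℤ) + 1)).natAbs) = fun n : ℕ => q * q ^ n := by
      funext n
      rw [Int.natAbs_neg, show ((n:ℤ) + 1).natAbs = n + 1 by omega, pow_succ']
    rw [e]; exact this
  have := HasSum.of_nat_of_neg_add_one (f := fun z : ℤ => q ^ z.natAbs) ha hb
  refine (sum_le_hasSum T (fun _ _ => by positivity) this).trans ?_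
  have hq : 0 < 1 - q := by linarith
  rw [← one_add_mul, ← div_eq_mul_inv, div_le_iff₀ hq]
  nlinarith

theorem gs_mgf (n : ℕ) (a : Fin n → ℝ) (ha : ∀ j, |a j| ≤ 1) (l : ℝ) :
    ∑ s : Fin n → Bool, Real.exp (l * ∑ j, a j * gsg (s j)) ≤ 2 ^ n * Real.exp (l ^ 2 * n / 2) := by
  have : ∀ s : Fin n → Bool, Real.exp (l * ∑ j, a j * gsg (s j)) = ∏ j, Real.exp (l * (a j * gsg (s j))) := by
    intro s; rw [Finset.mul_sum, Real.exp_sum]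
  simp_rw [this]
  have h2 := Finset.prod_univ_sum (fun _ : Fin n => (Finset.univ : Finset Bool)) (fun j b => Real.exp (l * (a j * gsg b)))
  rw [Fintype.piFinset_univ] at h2
  rw [← h2]
  have h3 : ∀ j : Fin n, ∑ b : Bool, Real.exp (l * (a j * gsg b)) ≤ 2 * Real.exp (l ^ 2 / 2) := by
    intro j
    have hc := Real.cosh_le_exp_half_sq (l * a j)
    have hc2 : Real.exp ((l * a j) ^ 2 / 2) ≤ Real.exp (l ^ 2 / 2) := by
      apply Real.exp_le_exp.2
      have : (a j) ^ 2 ≤ 1 := by rw [← sq_abs]; nlinarith [abs_nonneg (a j), ha j]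
      nlinarith [mul_le_mul_of_nonneg_left this (sq_nonneg l)]
    rw [Real.cosh_eq] at hc
    simp [gsg]
    linarith
  refine (Finset.prod_le_prod (fun _ _ => by positivity) (fun j _ => h3 j)).trans ?_
  rw [Finset.prod_const, Finset.card_univ, Fintype.card_fin, mul_pow, ← Real.exp_nat_mul]
  apply le_of_eq; congr 2; ring

theorem gs_round (t θ : ℝ) (hθ : 4 ≤ θ) :
    |((round t : ℤ) : ℝ)| ≤ Real.exp (-(θ / 4)) * (Real.exp (θ * t) + Real.exp (-(θ * t))) := by
  by_cases h : round t = 0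
  · rw [h]; simp; positivity
  have hr := abs_sub_round t
  have h1 : (1:ℝ) ≤ |((round t : ℤ) : ℝ)| := by
    exact_mod_cast Int.one_le_abs h
  have h2 : |((round t : ℤ) : ℝ)| ≤ |t| + 1/2 := by
    have := abs_sub_abs_le_abs_sub ((round t : ℤ) : ℝ) t
    rw [abs_sub_comm] at this; linarith
  have ht : 1/2 ≤ |t| := by linarith
  have h3 : Real.exp (θ * |t|) ≤ Real.exp (θ * t) + Real.exp (-(θ * t)) := by
    rcases abs_cases t with ⟨h, _⟩ | ⟨h, _⟩ <;> rw [h]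
    · linarith [Real.exp_pos (-(θ * t))]
    · rw [mul_neg]; linarith [Real.exp_pos (θ * t)]
  have h4 : |((round t : ℤ) : ℝ)| ≤ Real.exp (-(θ / 4)) * Real.exp (θ * |t|) := by
    rw [← Real.exp_add]
    have := Real.add_one_le_exp (-(θ / 4) + θ * |t|)
    nlinarith
  exact h4.trans (mul_le_mul_of_nonneg_left h3 (Real.exp_pos _).le)

theorem gs_entropy (δ : ℝ) (hδ : 0 < δ) : ∃ C₀ : ℝ, 0 < C₀ ∧ ∀ n m : ℕ, 0 < n →
    ∀ A : Matrix (Fin m) (Fin n) ℝ, (∀ i j, |A i j| ≤ 1) →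
    ∃ S : Finset (Fin n → Bool), 2 ^ n * Real.exp (-(δ * n)) ≤ S.card ∧
      ∀ s ∈ S, ∀ s' ∈ S, ∀ i, |∑ j, A i j * (gsg (s j) - gsg (s' j))|
        ≤ C₀ * Real.sqrt ((n : ℝ) * Real.log ((m : ℝ) / (n : ℝ) + 2)) := by
  set M : ℝ := 1 + 16 / δ with hM
  have hM1 : 1 < M := by rw [hM]; have : 0 < 16 / δ := by positivity
                         linarith
  set c : ℝ := 4 * M / δ with hc
  have hcpos : 0 < c := by positivity
  refine ⟨Real.sqrt (32 * (1 + c)), by positivity, ?_⟩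
  intro n m hn A hA
  set C₀ : ℝ := Real.sqrt (32 * (1 + c)) with hC
  have hCsq : C₀ ^ 2 = 32 * (1 + c) := Real.sq_sqrt (by positivity)
  have hCpos : 0 < C₀ := by positivity
  have hn' : (0:ℝ) < n := by exact_mod_cast hn
  set L := Real.log ((m : ℝ) / (n : ℝ) + 2) with hL
  have hX : (2:ℝ) ≤ (m : ℝ) / (n : ℝ) + 2 := by
    have : 0 ≤ (m : ℝ) / (n : ℝ) := by positivity
    linarith
  have hL2 : 1/2 ≤ L := by
    have := Real.log_le_log (by norm_num) hX
    have := Real.log_two_gt_d9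
    linarith
  have hLexp : Real.exp L = (m : ℝ) / (n : ℝ) + 2 := Real.exp_log (by linarith)
  have hm : (m:ℝ) ≤ n * Real.exp L := by
    rw [hLexp, mul_add, mul_div_cancel₀ _ hn'.ne']; linarith
  set Δ := C₀ * Real.sqrt (n * L) with hΔ
  have hΔpos : 0 < Δ := by
    have : 0 < n * L := by positivity
    positivity
  have hΔsq : Δ ^ 2 = C₀ ^ 2 * (n * L) := by
    rw [hΔ, mul_pow, Real.sq_sqrt (show (0:ℝ) ≤ n * L by positivity)]
  set k : (Fin n → Bool) → (Fin m → ℤ) := fun s i => round ((∑ j, A i j * gsg (s j)) / Δ) with hk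
  set q := Real.exp (-(M * L)) with hq
  have hqpos : 0 < q := Real.exp_pos _
  have hqhalf : q ≤ 1/2 := by
    have : q ≤ Real.exp (-L) := Real.exp_le_exp.2 (by nlinarith)
    rw [Real.exp_neg, hLexp] at this
    refine this.trans ?_
    rw [one_div]; exact inv_anti₀ (by norm_num) hX
  -- expectation of |k|
  have hEk : ∀ i, ∑ s, |((k s i : ℤ) : ℝ)| ≤ 2 ^ n * (2 * Real.exp (-(C₀ ^ 2 * L / 32))) := by
    intro i
    set θ := C₀ ^ 2 * L / 4 with hθ
    have hθ4 : 4 ≤ θ := by rw [hθ, hCsq]; nlinarith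
    have h1 : ∀ s, |((k s i : ℤ) : ℝ)| ≤ Real.exp (-(θ / 4)) *
        (Real.exp ((θ / Δ) * ∑ j, A i j * gsg (s j)) + Real.exp (-(θ / Δ) * ∑ j, A i j * gsg (s j))) := by
      intro s
      have := gs_round ((∑ j, A i j * gsg (s j)) / Δ) θ hθ4
      convert this using 4
      · ring
      · ring
    refine (Finset.sum_le_sum (fun s _ => h1 s)).trans ?_
    rw [← Finset.mul_sum, Finset.sum_add_distrib]
    have a1 := gs_mgf n (A i) (hA i) (θ / Δ)
    have a2 := gs_mgf n (A i) (hA i) (-(θ / Δ))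
    rw [neg_sq] at a2
    have e : (θ / Δ) ^ 2 * n / 2 = C₀ ^ 2 * L / 32 := by
      rw [div_pow, hΔsq, hθ]; field_simp; norm_num
    rw [e] at a1 a2
    have e2 : Real.exp (-(C₀ ^ 2 * L / 32)) = Real.exp (-(θ / 4)) * Real.exp (C₀ ^ 2 * L / 32) := by
      rw [← Real.exp_add]; congr 1; rw [hθ]; ring
    rw [e2]
    nlinarith [Real.exp_pos (-(θ / 4))]
  set Z : (Fin n → Bool) → ℝ := fun s => M * L * ∑ i, |((k s i : ℤ) : ℝ)| with hZ
  have hEZ : ∑ s, Z s ≤ 2 ^ n * (δ / 2 * n) := by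
    have h1 : ∑ s, Z s ≤ M * L * (m * (2 ^ n * (2 * Real.exp (-(C₀ ^ 2 * L / 32))))) := by
      rw [hZ, ← Finset.mul_sum, Finset.sum_comm]
      refine mul_le_mul_of_nonneg_left ?_ (by positivity)
      refine (Finset.sum_le_sum (fun i _ => hEk i)).trans ?_
      simp
    refine h1.trans ?_
    have e : Real.exp (-(C₀ ^ 2 * L / 32)) = Real.exp (-L) * Real.exp (-(c * L)) := by
      rw [← Real.exp_add, hCsq]; congr 1; ring
    have h2 : (m:ℝ) * Real.exp (-L) ≤ n := by
      rw [Real.exp_neg, ← div_eq_mul_inv, div_le_iff₀ (Real.exp_pos _)]; exact hm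
    have h3 : c * L * Real.exp (-(c * L)) ≤ 1 := by
      rw [Real.exp_neg, ← div_eq_mul_inv, div_le_iff₀ (Real.exp_pos _)]
      linarith [Real.add_one_le_exp (c * L)]
    have h4 : M * L * Real.exp (-(c * L)) ≤ δ / 4 := by
      have : c * δ = 4 * M := by rw [hc]; field_simp
      have h5 : M * L * Real.exp (-(c * L)) = δ / 4 * (c * L * Real.exp (-(c * L))) := by
        rw [show M = c * δ / 4 by linarith]; ring
      rw [h5]
      nlinarith
    rw [e]
    have h5 := mul_le_mul h4 h2 (by positivity) (by positivity)
    have : (0:ℝ) < 2 ^ n := by positivity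
    calc M * L * (m * (2 ^ n * (2 * (Real.exp (-L) * Real.exp (-(c * L))))))
        = 2 * 2 ^ n * ((M * L * Real.exp (-(c * L))) * (m * Real.exp (-L))) := by ring
      _ ≤ 2 * 2 ^ n * (δ / 4 * n) := by gcongr
      _ = _ := by ring
  -- Jensen
  have hJ : 2 ^ n * Real.exp (-(δ / 2 * n)) ≤ ∑ s, Real.exp (-Z s) := by
    have h1 : ∀ s, Real.exp (-(δ / 2 * n)) * (1 + (δ / 2 * n - Z s)) ≤ Real.exp (-Z s) := by
      intro s
      have : Real.exp (-Z s) = Real.exp (-(δ / 2 * n)) * Real.exp (δ / 2 * n - Z s) := by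
        rw [← Real.exp_add]; congr 1; ring
      rw [this]
      have := Real.add_one_le_exp (δ / 2 * n - Z s)
      exact mul_le_mul_of_nonneg_left (by linarith) (Real.exp_pos _).le
    refine le_trans ?_ (Finset.sum_le_sum (fun s _ => h1 s))
    rw [← Finset.mul_sum, mul_comm]
    refine mul_le_mul_of_nonneg_left ?_ (Real.exp_pos _).le
    rw [Finset.sum_add_distrib, Finset.sum_sub_distrib]
    simp
    linarith
  -- weights
  set w : (Fin m → ℤ) → ℝ := fun v => ∏ i, q ^ (v i).natAbs with hw
  have hwZ : ∀ s, Real.exp (-Z s) = w (k s) := by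
    intro s
    simp only [hw, hZ, hq]
    simp_rw [← Real.exp_nat_mul]
    rw [← Real.exp_sum, Finset.mul_sum, ← Finset.sum_neg_distrib]
    congr 1
    apply Finset.sum_congr rfl
    intro i _
    rw [Nat.cast_natAbs, Int.cast_abs]; ring
  have hW : ∑ v ∈ Finset.univ.image k, w v ≤ Real.exp (δ / 2 * n) := by
    have hsub : Finset.univ.image k ⊆ Fintype.piFinset (fun i => Finset.univ.image (fun s => k s i)) := by
      intro v hv
      obtain ⟨s, _, rfl⟩ := Finset.mem_image.1 hv
      rw [Fintype.mem_piFinset]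
      intro i
      exact Finset.mem_image_of_mem _ (Finset.mem_univ s)
    refine (Finset.sum_le_sum_of_subset_of_nonneg hsub (fun _ _ _ => by positivity)).trans ?_
    simp only [hw]
    rw [← Finset.prod_univ_sum (fun i => Finset.univ.image (fun s => k s i)) (fun _ z => q ^ z.natAbs)]
    refine (Finset.prod_le_prod (fun _ _ => by positivity)
      (fun i _ => (gs_intsum q hqpos.le hqhalf _).trans ((add_comm _ _).trans_le (Real.add_one_le_exp (4 * q))))).trans ?_
    rw [Finset.prod_const, Finset.card_univ, Fintype.card_fin, ← Real.exp_nat_mul]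
    apply Real.exp_le_exp.2
    have h1 : q = Real.exp (-L) * Real.exp (-(16 / δ * L)) := by
      rw [hq, ← Real.exp_add, hM]; congr 1; ring
    have h2 : (m:ℝ) * Real.exp (-L) ≤ n := by
      rw [Real.exp_neg, ← div_eq_mul_inv, div_le_iff₀ (Real.exp_pos _)]; exact hm
    have h3 : Real.exp (-(16 / δ * L)) ≤ δ / 8 := by
      have : 8 / δ ≤ Real.exp (16 / δ * L) := by
        have h := Real.add_one_le_exp (16 / δ * L)
        have h' : 8 / δ ≤ 16 / δ * L := by
          rw [div_mul_eq_mul_div]; gcongr; linarith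
        linarith
      rw [Real.exp_neg, show δ / 8 = (8 / δ)⁻¹ by rw [inv_div]]
      exact inv_anti₀ (by positivity) this
    have h5 := mul_le_mul h3 h2 (by positivity) (by positivity)
    rw [h1]; linarith
  -- pigeonhole
  obtain ⟨v, hv⟩ : ∃ v, 2 ^ n * Real.exp (-(δ * n)) ≤ ((Finset.univ.filter (fun s => k s = v)).card : ℝ) := by
    by_contra! hcon
    have h1 : ∑ s, Real.exp (-Z s) = ∑ v ∈ Finset.univ.image k,
        ((Finset.univ.filter (fun s => k s = v)).card : ℝ) * w v := by
      rw [← Finset.sum_fiberwise_of_maps_to (g := k) (t := Finset.univ.image k)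
        (fun s _ => Finset.mem_image_of_mem _ (Finset.mem_univ s))]
      apply Finset.sum_congr rfl
      intro v _
      rw [← nsmul_eq_mul, ← Finset.sum_const]
      apply Finset.sum_congr rfl
      intro s hs
      rw [hwZ, (Finset.mem_filter.1 hs).2]
    have h2 : ∑ v ∈ Finset.univ.image k, ((Finset.univ.filter (fun s => k s = v)).card : ℝ) * w v
        < ∑ v ∈ Finset.univ.image k, (2 ^ n * Real.exp (-(δ * n))) * w v := by
      apply Finset.sum_lt_sum_of_nonempty (Finset.univ_nonempty.image k)
      intro v _
      have : 0 < w v := Finset.prod_pos (fun _ _ => by positivity)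
      exact mul_lt_mul_of_pos_right (hcon v) this
    rw [← Finset.mul_sum] at h2
    have h3 : 2 ^ n * Real.exp (-(δ * n)) * ∑ v ∈ Finset.univ.image k, w v
        ≤ 2 ^ n * Real.exp (-(δ * n)) * Real.exp (δ / 2 * n) := by gcongr
    rw [mul_assoc (2 ^ n) _ (Real.exp (δ / 2 * n)), ← Real.exp_add, show -(δ * n) + δ / 2 * n = -(δ / 2 * n) by ring] at h3
    linarith
  refine ⟨_, hv, ?_⟩
  intro s hs s' hs' i
  have e1 := (Finset.mem_filter.1 hs).2
  have e2 := (Finset.mem_filter.1 hs').2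
  have e3 : k s i = k s' i := by rw [e1, e2]
  simp only [hk] at e3
  have r1 := abs_sub_round ((∑ j, A i j * gsg (s j)) / Δ)
  have r2 := abs_sub_round ((∑ j, A i j * gsg (s' j)) / Δ)
  rw [e3] at r1
  rw [abs_le] at r1 r2
  have : |(∑ j, A i j * gsg (s j)) / Δ - (∑ j, A i j * gsg (s' j)) / Δ| ≤ 1 := by
    rw [abs_le]; constructor <;> linarith [r1.1, r1.2, r2.1, r2.2]
  rw [← sub_div, abs_div, abs_of_pos hΔpos, div_le_one hΔpos, ← Finset.sum_sub_distrib] at this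
  simpa [mul_sub] using this

theorem gs_fiber (n : ℕ) (S : Finset (Fin n → Bool)) (I : Finset (Fin n)) :
    ∃ T : Finset (Fin n → Bool), T ⊆ S ∧ S.card ≤ 2 ^ I.card * T.card ∧
      ∀ s ∈ T, ∀ s' ∈ T, ∀ j ∈ I, s j = s' j := by
  classical
  let r : (Fin n → Bool) → (I → Bool) := fun s j => s j
  obtain ⟨v, _, hv⟩ := Finset.exists_max_image (Finset.univ : Finset (I → Bool))
    (fun v => (S.filter (fun s => r s = v)).card) Finset.univ_nonempty
  refine ⟨S.filter (fun s => r s = v), Finset.filter_subset _ _, ?_, ?_⟩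
  · rw [Finset.card_eq_sum_card_fiberwise (f := r) (t := Finset.univ) (fun _ _ => by simp)]
    refine (Finset.sum_le_card_nsmul _ _ _ hv).trans ?_
    simp
  · intro s hs s' hs' j hj
    have e1 := (Finset.mem_filter.1 hs).2
    have e2 := (Finset.mem_filter.1 hs').2
    exact congrFun (e1.trans e2.symm) ⟨j, hj⟩

theorem gs_count (n : ℕ) (l : ℝ) (hl : 0 < l) :
    ((Finset.univ.filter (fun I : Finset (Fin n) => (I.card : ℝ) ≤ l ^ 2 * n)).card : ℝ)
      ≤ Real.exp (2 * l * n) := by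
  have h1 : ∑ I : Finset (Fin n), l ^ I.card = (l + 1) ^ n := by
    have := Fintype.sum_pow_mul_eq_add_pow (Fin n) l 1
    simpa using this
  have h2 : (l + 1) ^ n ≤ Real.exp (l * n) := by
    rw [mul_comm, Real.exp_nat_mul]
    exact pow_le_pow_left₀ (by positivity) (Real.add_one_le_exp l) n
  have h3 : ((Finset.univ.filter (fun I : Finset (Fin n) => (I.card : ℝ) ≤ l ^ 2 * n)).card : ℝ)
      * Real.exp (-(l * n)) ≤ ∑ I : Finset (Fin n), l ^ I.card := by
    rw [← nsmul_eq_mul, ← Finset.sum_const]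
    refine (Finset.sum_le_sum (g := fun I => l ^ I.card) ?_).trans
      (Finset.sum_le_sum_of_subset_of_nonneg (Finset.subset_univ _) (fun _ _ _ => by positivity))
    intro I hI
    have hI := (Finset.mem_filter.1 hI).2
    have h4 : Real.exp (-(1 / l)) ≤ l := by
      rw [Real.exp_neg]
      have : 1 / l ≤ Real.exp (1 / l) := by linarith [Real.add_one_le_exp (1 / l)]
      calc (Real.exp (1 / l))⁻¹ ≤ (1 / l)⁻¹ := inv_anti₀ (by positivity) this
        _ = l := by simp
    calc Real.exp (-(l * n)) ≤ Real.exp (I.card * (-(1 / l))) := by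
          apply Real.exp_le_exp.2
          have : (I.card : ℝ) * (1 / l) ≤ l * n := by
            rw [mul_one_div, div_le_iff₀ hl]; nlinarith
          linarith
      _ = Real.exp (-(1 / l)) ^ I.card := Real.exp_nat_mul _ _
      _ ≤ l ^ I.card := pow_le_pow_left₀ (Real.exp_pos _).le h4 _
  have h5 := h3.trans (h1.le.trans h2)
  rw [Real.exp_neg, ← div_eq_mul_inv, div_le_iff₀ (Real.exp_pos _), ← Real.exp_add] at h5
  refine h5.trans (le_of_eq ?_); congr 1; ring

theorem gs_signs (n : ℕ) (κ l : ℝ) (hκ : 0 < κ) (hκ1 : κ ≤ 1) (hl : l = κ ^ 2 / 32)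
    (S : Finset (Fin n → Bool)) (hS : 2 ^ n * Real.exp (-(l * n)) ≤ S.card) :
    ∃ (T : Finset (Fin n) → Finset (Fin n → Bool)) (Bad : Finset (Fin n → Bool)),
      (∀ I, T I ⊆ S) ∧ (∀ I, ∀ s ∈ T I, ∀ s' ∈ T I, ∀ j ∈ I, s j = s' j) ∧
      (Bad.card : ℝ) ≤ 2 ^ n * Real.exp (-(4 * l * n)) ∧
      ∀ σ, σ ∉ Bad → ∀ I : Finset (Fin n), (I.card : ℝ) ≤ l ^ 2 * n →
        ∃ s ∈ T I, (hammingDist σ s : ℝ) ≤ κ * n := by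
  classical
  have hlpos : 0 < l := by rw [hl]; positivity
  have hl1 : l ≤ 1 := by rw [hl]; nlinarith
  choose T hT1 hT2 hT3 using gs_fiber n S
  refine ⟨T, (Finset.univ.filter (fun I : Finset (Fin n) => (I.card : ℝ) ≤ l ^ 2 * n)).biUnion
    (fun I => Finset.univ.filter (fun x : Fin n → Bool => ∀ s ∈ T I, κ * n < hammingDist x s)),
    hT1, hT3, ?_, ?_⟩
  · have h1 : ∀ I ∈ Finset.univ.filter (fun I : Finset (Fin n) => (I.card : ℝ) ≤ l ^ 2 * n),
        ((Finset.univ.filter (fun x : Fin n → Bool => ∀ s ∈ T I, κ * n < hammingDist x s)).card : ℝ)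
          ≤ 2 ^ n * Real.exp (-(6 * l * n)) := by
      intro I hI
      have hI := (Finset.mem_filter.1 hI).2
      have hb := gs_blow n (T I) (κ / 2) (κ * n) (by positivity)
      set N := ((Finset.univ.filter (fun x : Fin n → Bool => ∀ s ∈ T I, κ * n < hammingDist x s)).card : ℝ)
      have hN : 0 ≤ N := by positivity
      have e : (κ / 2) ^ 2 * n - κ / 2 * (κ * n) = -(8 * l * n) := by rw [hl]; ring
      rw [e] at hb
      have h2 : (S.card : ℝ) ≤ 2 ^ I.card * (T I).card := by exact_mod_cast hT2 I
      have h3 : (2:ℝ) ^ I.card ≤ Real.exp (l * n) := by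
        calc (2:ℝ) ^ I.card ≤ Real.exp 1 ^ I.card :=
              pow_le_pow_left₀ (by norm_num) (by linarith [Real.add_one_le_exp (1:ℝ)]) _
          _ = Real.exp I.card := by rw [← Real.exp_nat_mul, mul_one]
          _ ≤ _ := by
            apply Real.exp_le_exp.2
            have : l ^ 2 * n ≤ l * n := by
              apply mul_le_mul_of_nonneg_right _ (Nat.cast_nonneg n); nlinarith
            linarith
      have h4 : 2 ^ n * Real.exp (-(l * n)) ≤ Real.exp (l * n) * (T I).card :=
        hS.trans (h2.trans (by gcongr))
      have h5 : N * (2 ^ n * Real.exp (-(l * n))) ≤ Real.exp (l * n) * (4 ^ n * Real.exp (-(8 * l * n))) := by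
        calc N * (2 ^ n * Real.exp (-(l * n))) ≤ N * (Real.exp (l * n) * (T I).card) := by gcongr
          _ = Real.exp (l * n) * (N * (T I).card) := by ring
          _ ≤ _ := by gcongr
      have e2 : Real.exp (l * n) * (4 ^ n * Real.exp (-(8 * l * n)))
          = (2 ^ n * Real.exp (-(6 * l * n))) * (2 ^ n * Real.exp (-(l * n))) := by
        rw [mul_mul_mul_comm, ← mul_pow, ← Real.exp_add, mul_left_comm, ← Real.exp_add]
        norm_num; ring
      rw [e2] at h5
      exact le_of_mul_le_mul_right h5 (by positivity)
    have h2 : ((Finset.univ.filter (fun I : Finset (Fin n) => (I.card : ℝ) ≤ l ^ 2 * n)).biUnion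
      (fun I => Finset.univ.filter (fun x : Fin n → Bool => ∀ s ∈ T I, κ * n < hammingDist x s))).card
      ≤ ∑ I ∈ Finset.univ.filter (fun I : Finset (Fin n) => (I.card : ℝ) ≤ l ^ 2 * n),
        (Finset.univ.filter (fun x : Fin n → Bool => ∀ s ∈ T I, κ * n < hammingDist x s)).card :=
      Finset.card_biUnion_le
    have h3 := (Nat.cast_le (α := ℝ)).2 h2
    refine h3.trans ?_
    rw [Nat.cast_sum]
    refine (Finset.sum_le_card_nsmul _ _ _ h1).trans ?_
    rw [nsmul_eq_mul]
    refine (mul_le_mul_of_nonneg_right (gs_count n l hlpos) (by positivity)).trans (le_of_eq ?_)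
    rw [mul_left_comm, ← Real.exp_add]; congr 2; ring
  · intro σ hσ I hI
    by_contra! hcon
    apply hσ
    rw [Finset.mem_biUnion]
    exact ⟨I, by simpa using hI, by simpa using hcon⟩

theorem gs_half (b : Bool) : gaussianReal 0 1 {x : ℝ | decide (0 < x) = b} ≤ 1 / 2 := by
  have h1 : gaussianReal 0 1 (Set.Ioi (0:ℝ)) = gaussianReal 0 1 (Set.Iio (0:ℝ)) := by
    have h := gaussianReal_map_neg (μ := 0) (v := 1)
    rw [neg_zero] at h
    conv_lhs => rw [← h]
    rw [Measure.map_apply (by fun_prop) measurableSet_Ioi]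
    congr 1; ext x; simp
  have h2 : gaussianReal 0 1 (Set.Iic (0:ℝ)) = gaussianReal 0 1 (Set.Iio (0:ℝ)) := by
    have := nullSingletonClass_gaussianReal (μ := 0) (v := 1) one_ne_zero
    exact (measure_congr Iio_ae_eq_Iic).symm
  have h3 : gaussianReal 0 1 (Set.Ioi (0:ℝ)) + gaussianReal 0 1 (Set.Iic (0:ℝ)) = 1 := by
    rw [← Set.compl_Ioi]
    exact prob_add_prob_compl measurableSet_Ioi
  rw [h2, ← h1] at h3
  have h4 : gaussianReal 0 1 (Set.Ioi (0:ℝ)) = 1 / 2 := by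
    rw [ENNReal.eq_div_iff (by norm_num) (by norm_num), two_mul, h3]
  cases b
  · have : {x : ℝ | decide (0 < x) = false} = Set.Iic 0 := by ext x; simp
    rw [this, h2, ← h1, h4]
  · have : {x : ℝ | decide (0 < x) = true} = Set.Ioi 0 := by ext x; simp
    rw [this, h4]

theorem gs_signprob (n : ℕ) (B : Finset (Fin n → Bool)) (r : ℝ) (hr : (B.card : ℝ) ≤ 2 ^ n * r) :
    gaussianPi n {g | (fun j => decide (0 < g j)) ∈ B} ≤ ENNReal.ofReal r := by
  have h1 : {g : Fin n → ℝ | (fun j => decide (0 < g j)) ∈ B}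
      = ⋃ σ ∈ B, Set.pi Set.univ (fun j => {x : ℝ | decide (0 < x) = σ j}) := by
    ext g
    simp only [Set.mem_ofPred_eq, Set.mem_iUnion, Set.mem_pi, Set.mem_univ, true_implies, exists_prop]
    constructor
    · intro h; exact ⟨_, h, fun _ => rfl⟩
    · rintro ⟨σ, h, h2⟩
      have : (fun j => decide (0 < g j)) = σ := funext h2
      rwa [this]
  rw [h1]
  refine (measure_biUnion_finset_le _ _).trans ?_
  have h2 : ∀ σ ∈ B, gaussianPi n (Set.pi Set.univ (fun j => {x : ℝ | decide (0 < x) = σ j})) ≤ (1 / 2) ^ n := by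
    intro σ _
    rw [gaussianPi, Measure.pi_pi]
    refine (Finset.prod_le_prod' (fun j _ => gs_half (σ j))).trans ?_
    simp
  refine (Finset.sum_le_card_nsmul _ _ _ h2).trans ?_
  have h3 : (B.card : ℝ) * (1 / 2) ^ n ≤ r := by
    rw [one_div, inv_pow, ← div_eq_mul_inv, div_le_iff₀ (by positivity)]; linarith
  have h4 : B.card • ((1:ENNReal) / 2) ^ n = ENNReal.ofReal ((B.card : ℝ) * (1 / 2) ^ n) := by
    rw [ENNReal.ofReal_mul (by positivity), ENNReal.ofReal_pow (by positivity),
      ENNReal.ofReal_div_of_pos (by norm_num)]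
    simp
  rw [h4]
  exact ENNReal.ofReal_le_ofReal h3

theorem gs_l2 (n : ℕ) (hn : 0 < n) :
    gaussianPi n {g | 20 * (n:ℝ) ≤ ∑ j, (g j) ^ 2} ≤ ENNReal.ofReal (1 / 20) := by
  have : IsProbabilityMeasure (gaussianPi n) := by unfold gaussianPi; infer_instance
  have hi0 : Integrable (fun x : ℝ => x ^ 2) (gaussianReal 0 1) :=
    (memLp_id_gaussianReal (μ := 0) (v := 1) 2).integrable_sq
  have hv : ∫ x : ℝ, x ^ 2 ∂(gaussianReal 0 1) = 1 := by
    have h := variance_fun_id_gaussianReal (μ := 0) (v := 1)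
    rw [variance_eq_integral (by fun_prop)] at h
    simpa using h
  have hi : ∀ j ∈ Finset.univ, Integrable (fun g : Fin n → ℝ => (g j) ^ 2) (gaussianPi n) := by
    intro j _
    exact integrable_comp_eval (μ := fun _ : Fin n => gaussianReal 0 1) (f := fun x : ℝ => x ^ 2) hi0
  have hE : ∫ g, ∑ j, (g j) ^ 2 ∂(gaussianPi n) = n := by
    rw [integral_finsetSum _ hi]
    have : ∀ j, ∫ g, (g j) ^ 2 ∂(gaussianPi n) = 1 := by
      intro j
      rw [← hv]
      exact integral_comp_eval (μ := fun _ : Fin n => gaussianReal 0 1) (f := fun x : ℝ => x ^ 2) hi0.1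
    simp [this]
  have := mul_meas_ge_le_integral_of_nonneg (μ := gaussianPi n) (f := fun g => ∑ j, (g j) ^ 2)
    (Filter.Eventually.of_forall (fun g => Finset.sum_nonneg (fun j _ => sq_nonneg _)))
    (integrable_finsetSum _ hi) (20 * n)
  rw [hE] at this
  have hn' : (0:ℝ) < n := by exact_mod_cast hn
  rw [← ofReal_measureReal]
  apply ENNReal.ofReal_le_ofReal
  nlinarith

theorem gs_l1 : ∃ μ : ℝ, 0 < μ ∧ ∀ n : ℕ, 0 < n →
    gaussianPi n {g | ∑ j, |g j| ≤ μ * n / 2} ≤ ENNReal.ofReal (4 / (μ ^ 2 * n)) := by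
  have hm0 : MemLp (fun x : ℝ => |x|) 2 (gaussianReal 0 1) :=
    (memLp_id_gaussianReal (μ := 0) (v := 1) 2).abs
  have hi0 : Integrable (fun x : ℝ => |x|) (gaussianReal 0 1) := hm0.integrable (by norm_num)
  have hv : ∫ x : ℝ, x ^ 2 ∂(gaussianReal 0 1) = 1 := by
    have h := variance_fun_id_gaussianReal (μ := 0) (v := 1)
    rw [variance_eq_integral (by fun_prop)] at h
    simpa using h
  set μ := ∫ x : ℝ, |x| ∂(gaussianReal 0 1) with hμ
  have hvar : Var[fun x : ℝ => |x|; gaussianReal 0 1] ≤ 1 := by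
    rw [← hv]
    refine (variance_le_expectation_sq hm0.1).trans (le_of_eq ?_)
    simp
  have hμpos : 0 < μ := by
    rw [hμ, integral_pos_iff_support_of_nonneg (fun x => abs_nonneg x) hi0]
    have : Function.support (fun x : ℝ => |x|) = {0}ᶜ := by ext x; simp
    have hna := nullSingletonClass_gaussianReal (μ := 0) (v := 1) one_ne_zero
    rw [this, prob_compl_eq_one_sub (measurableSet_singleton _), measure_singleton]
    simp
  refine ⟨μ, hμpos, ?_⟩
  intro n hn
  have hn' : (0:ℝ) < n := by exact_mod_cast hn
  have : IsProbabilityMeasure (gaussianPi n) := by unfold gaussianPi; infer_instance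
  have hmem : ∀ j : Fin n, MemLp (fun g : Fin n → ℝ => |g j|) 2 (gaussianPi n) := by
    intro j
    exact hm0.comp_measurePreserving (measurePreserving_eval (fun _ : Fin n => gaussianReal 0 1) j)
  have hE : ∫ g, (∑ j, fun g : Fin n → ℝ => |g j|) g ∂(gaussianPi n) = n * μ := by
    simp only [Finset.sum_apply]
    rw [integral_finsetSum _ (fun j _ => (hmem j).integrable (by norm_num))]
    have : ∀ j, ∫ g, |g j| ∂(gaussianPi n) = μ := by
      intro j
      exact integral_comp_eval (μ := fun _ : Fin n => gaussianReal 0 1) (f := fun x : ℝ => |x|) hi0.1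
    simp [this]
  have hV : Var[∑ j, fun g : Fin n → ℝ => |g j|; gaussianPi n] ≤ n := by
    unfold gaussianPi
    rw [variance_sum_pi (μ := fun _ : Fin n => gaussianReal 0 1) (X := fun _ x => |x|) (fun _ => hm0)]
    refine (Finset.sum_le_sum (fun _ _ => hvar)).trans ?_
    simp
  have hch := meas_ge_le_variance_div_sq (μ := gaussianPi n) (X := ∑ j, fun g : Fin n → ℝ => |g j|)
    (memLp_finsetSum' _ (fun j _ => hmem j)) (c := μ * n / 2) (by positivity)
  rw [hE] at hch
  refine (measure_mono ?_).trans (hch.trans (ENNReal.ofReal_le_ofReal ?_))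
  · intro g hg
    simp only [Set.mem_ofPred_eq, Finset.sum_apply] at hg ⊢
    rw [abs_sub_comm]
    refine le_trans ?_ (le_abs_self _)
    linarith
  · rw [div_le_div_iff₀ (by positivity) (by positivity)]
    have : 0 < μ ^ 2 * n := by positivity
    nlinarith [mul_le_mul_of_nonneg_right hV this.le]

theorem gs_point (g τ : ℝ) (hτ : 0 < τ) (s s' : Bool) :
    2 * |g| - 4 * (2 * (τ * g ^ 2) + 1 / (4 * τ) * ((if decide (0 < g) ≠ s then (1:ℝ) else 0)
      + (if (!decide (0 < g)) ≠ s' then (1:ℝ) else 0))) ≤ g * (gsg s - gsg s') := by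
  have h : |g| ≤ τ * g ^ 2 + 1 / (4 * τ) := by
    have : τ * g ^ 2 + 1 / (4 * τ) - |g| = τ * (|g| - 1 / (2 * τ)) ^ 2 := by
      rw [← sq_abs]; field_simp; ring
    have h2 : 0 ≤ τ * (|g| - 1 / (2 * τ)) ^ 2 := by positivity
    linarith
  have h2 : 0 ≤ τ * g ^ 2 := by positivity
  by_cases hg : 0 < g
  · rw [abs_of_pos hg] at h ⊢
    cases s <;> cases s' <;> simp [gsg, hg] <;> simp at h <;> linarith
  · rw [abs_of_nonpos (not_lt.1 hg)] at h ⊢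
    cases s <;> cases s' <;> simp [gsg, hg] <;> simp at h <;> linarith

theorem gs_gain (n : ℕ) (μ κ : ℝ) (hμ : 0 < μ) (hκ : κ ≤ μ ^ 2 / 40960) (g : Fin n → ℝ)
    (h2 : ∑ j, (g j) ^ 2 ≤ 20 * n) (s s' : Fin n → Bool)
    (hs : (hammingDist (fun j => decide (0 < g j)) s : ℝ) ≤ κ * n)
    (hs' : (hammingDist (fun j => !decide (0 < g j)) s' : ℝ) ≤ κ * n) :
    2 * ∑ j, |g j| - μ / 4 * n ≤ ∑ j, g j * (gsg (s j) - gsg (s' j)) := by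
  set τ := μ / 1280 with hτ
  have hτ0 : 0 < τ := by positivity
  refine le_trans ?_ (Finset.sum_le_sum (fun j _ => gs_point (g j) τ hτ0 (s j) (s' j)))
  rw [Finset.sum_sub_distrib, ← Finset.mul_sum, ← Finset.mul_sum, Finset.sum_add_distrib,
    ← Finset.mul_sum, ← Finset.mul_sum, ← Finset.mul_sum, Finset.sum_add_distrib]
  have e1 : (hammingDist (fun j => decide (0 < g j)) s : ℝ)
      = ∑ j, if decide (0 < g j) ≠ s j then (1:ℝ) else 0 := by
    rw [hammingDist, Finset.card_filter]; push_cast; rfl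
  have e2 : (hammingDist (fun j => !decide (0 < g j)) s' : ℝ)
      = ∑ j, if (!decide (0 < g j)) ≠ s' j then (1:ℝ) else 0 := by
    rw [hammingDist, Finset.card_filter]; push_cast; rfl
  rw [← e1, ← e2]
  have hn : (0:ℝ) ≤ n := Nat.cast_nonneg n
  have a1 : τ * ∑ j, (g j) ^ 2 ≤ μ / 64 * n := by
    refine (mul_le_mul_of_nonneg_left h2 hτ0.le).trans (le_of_eq ?_)
    rw [hτ]; ring
  have a2 : 1 / (4 * τ) * ((hammingDist (fun j => decide (0 < g j)) s : ℝ)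
      + (hammingDist (fun j => !decide (0 < g j)) s' : ℝ)) ≤ μ / 64 * n := by
    have : (hammingDist (fun j => decide (0 < g j)) s : ℝ)
      + (hammingDist (fun j => !decide (0 < g j)) s' : ℝ) ≤ 2 * (μ ^ 2 / 40960 * n) := by
      have := mul_le_mul_of_nonneg_right hκ hn
      linarith
    refine (mul_le_mul_of_nonneg_left this (by positivity)).trans (le_of_eq ?_)
    rw [hτ]; field_simp; ring
  have a3 : 0 ≤ μ * n := by positivity
  linarith

theorem gs_det (m n : ℕ) (hn : 0 < n) (A : Matrix (Fin m) (Fin n) ℝ) (C₀ C μ η ε : ℝ)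
    (hC : C₀ ≤ C) (hε : 0 < ε) (hε1 : ε ≤ 1) (hη : η < μ / 12) (g x : Fin n → ℝ)
    (hx : x ∈ Gamma m n A C) (s s' : Fin n → Bool)
    (hA : ∀ i, |∑ j, A i j * (gsg (s j) - gsg (s' j))|
        ≤ C₀ * Real.sqrt ((n : ℝ) * Real.log ((m : ℝ) / (n : ℝ) + 2)))
    (hI : ∀ j, 1 - ε ≤ |x j| → s j = s' j)
    (h1 : μ * n / 2 ≤ ∑ j, |g j|)
    (hg : 2 * ∑ j, |g j| - μ / 4 * n ≤ ∑ j, g j * (gsg (s j) - gsg (s' j)))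
    (hopt : sSup {t | ∃ y ∈ Gamma m n A C, t = (∑ j, g j * y j) / Real.sqrt n}
                    - ε * η * Real.sqrt n ≤ (∑ j, g j * x j) / Real.sqrt n) : False := by
  set y : Fin n → ℝ := fun j => gsg (s j) - gsg (s' j) with hy
  set z : Fin n → ℝ := fun j => (1 - ε / 3) * x j + ε / 3 * y j with hz
  have hn' : (0:ℝ) < n := by exact_mod_cast hn
  have hsq : 0 < Real.sqrt n := by positivity
  have hle : ∀ w ∈ Gamma m n A C, ∑ j, g j * w j ≤ ∑ j, |g j| := by
    intro w hw
    apply Finset.sum_le_sum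
    intro j _
    refine (le_abs_self _).trans ?_
    rw [abs_mul]
    exact mul_le_of_le_one_right (abs_nonneg _) (hw.1 j)
  have hy2 : ∀ j, |y j| ≤ 2 := by
    intro j
    simp only [hy]
    cases s j <;> cases s' j <;> simp [gsg] <;> norm_num
  have hzG : z ∈ Gamma m n A C := by
    refine ⟨?_, ?_⟩
    · intro j
      have ha : |z j| ≤ (1 - ε / 3) * |x j| + ε / 3 * |y j| := by
        simp only [hz]
        refine (abs_add_le _ _).trans ?_
        rw [abs_mul, abs_mul, abs_of_nonneg (show 0 ≤ 1 - ε / 3 by linarith),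
          abs_of_pos (show 0 < ε / 3 by linarith)]
      have hx1 := hx.1 j
      by_cases hj : 1 - ε ≤ |x j|
      · have : y j = 0 := by simp [hy, hI j hj]
        rw [this] at ha
        simp at ha
        nlinarith [abs_nonneg (x j)]
      · push Not at hj
        have := hy2 j
        have hy0 := abs_nonneg (x j)
        nlinarith
    · intro i
      have hx2 := hx.2 i
      have hR : 0 ≤ Real.sqrt ((n : ℝ) * Real.log ((m : ℝ) / (n : ℝ) + 2)) := Real.sqrt_nonneg _
      set R := Real.sqrt ((n : ℝ) * Real.log ((m : ℝ) / (n : ℝ) + 2))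
      have hy3 : |A.mulVec y i| ≤ C * R := by
        have : A.mulVec y i = ∑ j, A i j * (gsg (s j) - gsg (s' j)) := by
          simp [Matrix.mulVec, dotProduct, hy]
        rw [this]
        exact (hA i).trans (mul_le_mul_of_nonneg_right hC hR)
      have hz1 : A.mulVec z i = (1 - ε / 3) * A.mulVec x i + ε / 3 * A.mulVec y i := by
        have : z = (1 - ε / 3) • x + (ε / 3) • y := by ext j; simp [hz]
        rw [this, Matrix.mulVec_add, Matrix.mulVec_smul, Matrix.mulVec_smul]
        simp
      rw [hz1]
      refine (abs_add_le _ _).trans ?_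
      rw [abs_mul, abs_mul, abs_of_nonneg (show 0 ≤ 1 - ε / 3 by linarith),
          abs_of_pos (show 0 < ε / 3 by linarith)]
      nlinarith
  have hsup : (∑ j, g j * z j) / Real.sqrt n
      ≤ sSup {t | ∃ y ∈ Gamma m n A C, t = (∑ j, g j * y j) / Real.sqrt n} := by
    apply le_csSup
    · refine ⟨(∑ j, |g j|) / Real.sqrt n, ?_⟩
      rintro t ⟨w, hw, rfl⟩
      exact div_le_div_of_nonneg_right (hle w hw) hsq.le
    · exact ⟨z, hzG, rfl⟩
  have h3 : (∑ j, g j * z j) / Real.sqrt n - ε * η * Real.sqrt n ≤ (∑ j, g j * x j) / Real.sqrt n := by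
    linarith
  have h4 : (∑ j, g j * z j) - ε * η * n ≤ ∑ j, g j * x j := by
    rw [sub_le_iff_le_add, div_le_iff₀ hsq, add_mul, div_mul_cancel₀ _ hsq.ne', mul_assoc,
      Real.mul_self_sqrt hn'.le] at h3
    linarith
  have h5 : ∑ j, g j * z j = (1 - ε / 3) * ∑ j, g j * x j + ε / 3 * ∑ j, g j * y j := by
    rw [Finset.mul_sum, Finset.mul_sum, ← Finset.sum_add_distrib]
    apply Finset.sum_congr rfl
    intro j _
    simp only [hz]; ring
  have h6 := hle x hx
  have h7 : μ / 4 * n ≤ ∑ j, g j * y j - ∑ j, g j * x j := by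
    have : ∑ j, g j * y j = ∑ j, g j * (gsg (s j) - gsg (s' j)) := rfl
    rw [this]; linarith
  have h8 : ε / 3 * (μ / 4 * n) ≤ ε * η * n := by
    have := mul_le_mul_of_nonneg_left h7 (show 0 ≤ ε / 3 by linarith)
    rw [h5] at h4
    linarith
  have h9 : ε * n * η < ε * n * (μ / 12) := mul_lt_mul_of_pos_left hη (by positivity)
  linarith

theorem gauss_program_stability :
    ∃ C₀ η : ℝ, 0 < C₀ ∧ 0 < η ∧ ∃ n₀ : ℕ, ∀ n : ℕ, n₀ ≤ n → ∀ m : ℕ, 0 < m →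
      ∀ A : Matrix (Fin m) (Fin n) ℝ, (∀ i j, |A i j| ≤ 1) →
        (4 / 5 : ENNReal) ≤
          ((gaussianPi n).prod (unifIcc C₀ (2 * C₀)))
            {p : (Fin n → ℝ) × ℝ |
              ∀ x ∈ Gamma m n A p.2,
                sSup {t | ∃ y ∈ Gamma m n A p.2, t = (∑ j, p.1 j * y j) / Real.sqrt n}
                    - (1 / Real.log n) * η * Real.sqrt n ≤ (∑ j, p.1 j * x j) / Real.sqrt n →
                  η * n ≤ (Set.ncard {j : Fin n | 1 - 1 / Real.log n ≤ |x j|} : ℝ)} := by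
  classical
  obtain ⟨μ, hμ, hl1⟩ := gs_l1
  set κ := min 1 (μ ^ 2 / 40960) with hκ
  have hκ0 : 0 < κ := lt_min one_pos (by positivity)
  set l := κ ^ 2 / 32 with hl
  have hl0 : 0 < l := by positivity
  set η := min (l ^ 2) (μ / 24) with hη
  have hη0 : 0 < η := lt_min (by positivity) (by positivity)
  obtain ⟨C₀, hC0, hent⟩ := gs_entropy l hl0
  refine ⟨C₀, η, hC0, hη0, 3 + ⌈80 / μ ^ 2⌉₊ + ⌈10 / l⌉₊, ?_⟩
  intro n hn m _ A hA
  have hn0 : 0 < n := by omega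
  have hn' : (0:ℝ) < n := by exact_mod_cast hn0
  have hnR : ((3 + ⌈80 / μ ^ 2⌉₊ + ⌈10 / l⌉₊ : ℕ) : ℝ) ≤ n := by exact_mod_cast hn
  push_cast at hnR
  have c1 := Nat.le_ceil (80 / μ ^ 2)
  have c2 := Nat.le_ceil (10 / l)
  have p1 : 0 < 80 / μ ^ 2 := by positivity
  have p2 : 0 < 10 / l := by positivity
  have hlog : 1 ≤ Real.log n := by
    rw [Real.le_log_iff_exp_le hn']
    linarith [Real.exp_one_lt_d9]
  have hn1 : 80 / μ ^ 2 ≤ n := by linarith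
  have hn2 : 10 / l ≤ n := by linarith
  have hε0 : 0 < 1 / Real.log n := by positivity
  have hε1 : 1 / Real.log n ≤ 1 := by rw [div_le_one (by linarith)]; exact hlog
  obtain ⟨S, hS, hSA⟩ := hent n m hn0 A hA
  obtain ⟨T, Bad, hT1, hT2, hBad, hgood⟩ := gs_signs n κ l hκ0 (min_le_left _ _) hl S hS
  set B := Bad ∪ Bad.image (fun σ j => !σ j) with hB
  have hBcard : (B.card : ℝ) ≤ 2 ^ n * (1 / 20) := by
    have h1 : B.card ≤ Bad.card + Bad.card :=
      (Finset.card_union_le _ _).trans (Nat.add_le_add_left Finset.card_image_le _)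
    have h2 : (B.card : ℝ) ≤ Bad.card + Bad.card := by exact_mod_cast h1
    have h3 : Real.exp (-(4 * l * n)) ≤ 1 / 40 := by
      have : 40 ≤ Real.exp (4 * l * n) := by
        have h := Real.add_one_le_exp (4 * l * n)
        rw [div_le_iff₀ hl0] at hn2
        linarith
      rw [Real.exp_neg, one_div]
      exact inv_anti₀ (by norm_num) this
    have h4 : (2:ℝ) ^ n * Real.exp (-(4 * l * n)) ≤ 2 ^ n * (1 / 40) := by gcongr
    linarith
  set E1 : Set (Fin n → ℝ) := {g | 20 * (n:ℝ) ≤ ∑ j, (g j) ^ 2}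
  set E2 : Set (Fin n → ℝ) := {g | ∑ j, |g j| ≤ μ * n / 2}
  set E3 : Set (Fin n → ℝ) := {g | (fun j => decide (0 < g j)) ∈ B}
  have hE : gaussianPi n (E1 ∪ E2 ∪ E3) ≤ 1 / 5 := by
    have b1 : gaussianPi n E1 ≤ ENNReal.ofReal (1 / 20) := gs_l2 n hn0
    have b2 : gaussianPi n E2 ≤ ENNReal.ofReal (1 / 20) := by
      refine (hl1 n hn0).trans (ENNReal.ofReal_le_ofReal ?_)
      rw [div_le_iff₀ (by positivity)] at hn1
      rw [div_le_div_iff₀ (by positivity) (by norm_num)]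
      linarith
    have b3 : gaussianPi n E3 ≤ ENNReal.ofReal (1 / 20) := gs_signprob n B _ hBcard
    refine (measure_union_le _ _).trans ((add_le_add ((measure_union_le _ _).trans (add_le_add b1 b2)) b3).trans ?_)
    rw [← ENNReal.ofReal_add (by norm_num) (by norm_num), ← ENNReal.ofReal_add (by norm_num) (by norm_num)]
    have : (1 / 5 : ENNReal) = ENNReal.ofReal (1 / 5) := by
      rw [ENNReal.ofReal_div_of_pos (by norm_num)]; simp
    rw [this]
    apply ENNReal.ofReal_le_ofReal; norm_num
  have hG : (4 / 5 : ENNReal) ≤ gaussianPi n (E1 ∪ E2 ∪ E3)ᶜ := by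
    have hP : IsProbabilityMeasure (gaussianPi n) := by unfold gaussianPi; infer_instance
    have h1 : (1 : ENNReal) ≤ gaussianPi n (E1 ∪ E2 ∪ E3) + gaussianPi n (E1 ∪ E2 ∪ E3)ᶜ := by
      rw [← measure_univ (μ := gaussianPi n), ← Set.union_compl_self (E1 ∪ E2 ∪ E3)]
      exact measure_union_le _ _
    have h2 : (4 / 5 : ENNReal) + 1 / 5 = 1 := by
      rw [ENNReal.div_add_div_same]; norm_num
      exact ENNReal.div_self (by norm_num) (by norm_num)
    have h3 : (4 / 5 : ENNReal) + 1 / 5 ≤ gaussianPi n (E1 ∪ E2 ∪ E3)ᶜ + 1 / 5 := by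
      rw [h2]
      refine h1.trans ?_
      rw [add_comm]
      exact add_le_add_right hE _
    exact (ENNReal.add_le_add_iff_right (by simp)).1 h3
  have hU : unifIcc C₀ (2 * C₀) (Set.Icc C₀ (2 * C₀)) = 1 := by
    rw [unifIcc, Measure.smul_apply, Measure.restrict_apply_self, smul_eq_mul]
    apply ENNReal.inv_mul_cancel
    · rw [Real.volume_Icc]; simp; linarith
    · rw [Real.volume_Icc]; simp
  have hSF : SFinite (unifIcc C₀ (2 * C₀)) := by unfold unifIcc; infer_instance
  calc (4 / 5 : ENNReal) ≤ gaussianPi n (E1 ∪ E2 ∪ E3)ᶜ * unifIcc C₀ (2 * C₀) (Set.Icc C₀ (2 * C₀)) := by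
        rw [hU, mul_one]; exact hG
    _ = ((gaussianPi n).prod (unifIcc C₀ (2 * C₀))) ((E1 ∪ E2 ∪ E3)ᶜ ×ˢ Set.Icc C₀ (2 * C₀)) :=
        (Measure.prod_prod _ _).symm
    _ ≤ _ := by
      apply measure_mono
      rintro ⟨g, C⟩ ⟨hg, hC⟩ x hx hopt
      simp only at hg hC hx hopt ⊢
      by_contra hcon
      push Not at hcon
      have hg1 : g ∉ E1 := fun h => hg (Or.inl (Or.inl h))
      have hg2 : g ∉ E2 := fun h => hg (Or.inl (Or.inr h))
      have hg3 : g ∉ E3 := fun h => hg (Or.inr h)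
      have hg1 : ∑ j, (g j) ^ 2 < 20 * n := not_le.1 hg1
      have hg2 : μ * n / 2 < ∑ j, |g j| := not_le.1 hg2
      have hg3 : (fun j => decide (0 < g j)) ∉ B := hg3
      set I : Finset (Fin n) := Finset.univ.filter (fun j => 1 - 1 / Real.log n ≤ |x j|) with hI
      have hIc : (I.card : ℝ) ≤ l ^ 2 * n := by
        have : Set.ncard {j : Fin n | 1 - 1 / Real.log n ≤ |x j|} = I.card := by
          rw [← Set.ncard_coe_finset]; congr 1; ext j; simp [hI]
        rw [this] at hcon
        have : η * n ≤ l ^ 2 * n := mul_le_mul_of_nonneg_right (min_le_left _ _) hn'.le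
        linarith
      have n1 : (fun j => decide (0 < g j)) ∉ Bad := fun h => hg3 (Finset.mem_union_left _ h)
      have n2 : (fun j => !decide (0 < g j)) ∉ Bad := fun h => hg3 (Finset.mem_union_right _
        (Finset.mem_image.2 ⟨_, h, by funext j; simp⟩))
      obtain ⟨s, hs, hds⟩ := hgood _ n1 I hIc
      obtain ⟨s', hs', hds'⟩ := hgood _ n2 I hIc
      refine gs_det m n hn0 A C₀ C μ η (1 / Real.log n) hC.1 hε0 hε1 ?_ g x hx s s'
        (hSA s (hT1 I hs) s' (hT1 I hs')) ?_ hg2.le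
        (gs_gain n μ κ hμ (min_le_right _ _) g hg1.le s s' hds hds') hopt
      · have : η ≤ μ / 24 := min_le_right _ _
        linarith
      · intro j hj
        exact hT2 I s hs s' hs' j (by simp [hI]; simpa using hj)
end

section
/- There exists an absolute constant c > 0 such that for every δ ∈ (0,1] there exist C₀ > 0 and n₀ with the following property. For all 0 ≤ ε ≤ c, all C ≥ C₀, all n ≥ n₀, all positive integers m, and every matrix A ∈ ℝ^{m×n} with ‖A‖_{1→∞} ≤ 1, if C' is sampled uniformly from the interval [C, 2C], then P[ OPT_A(C' + C·ε) − OPT_A(C') ≤ δ·ε·√n ] ≥ 5/6. -/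
open MeasureTheory ProbabilityTheory

/-- `OPT_A(C) = E_{g ~ N(0,Iₙ)}[sup_{y ∈ Γ_{A,C}} ⟨g,y⟩] / √n`. -/
noncomputable def OPT (m n : ℕ) (A : Matrix (Fin m) (Fin n) ℝ) (C : ℝ) : ℝ :=
  (∫ g, sSup {t | ∃ y ∈ Gamma m n A C, t = ∑ j, g j * y j}
    ∂(Measure.pi fun _ : Fin n => gaussianReal 0 1)) / Real.sqrt n

lemma units_sum (f : ℤˣ → ℝ) : ∑ a, f a = f 1 + f (-1) := by
  rw [show (Finset.univ : Finset ℤˣ) = {1, -1} from rfl]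
  rw [Finset.sum_pair (by decide)]

lemma cons_sum {n : ℕ} (f : (Fin (n+1) → ℤˣ) → ℝ) :
    ∑ x, f x = ∑ x : Fin n → ℤˣ, f (Fin.cons 1 x) + ∑ x : Fin n → ℤˣ, f (Fin.cons (-1) x) := by
  rw [← (Fin.consEquiv (fun _ : Fin (n+1) => ℤˣ)).sum_comp, Fintype.sum_prod_type, units_sum]
  rfl

lemma card_cube (n : ℕ) : Fintype.card (Fin n → ℤˣ) = 2 ^ n := by
  simp

lemma conc (t : ℝ) (ht : 0 ≤ t) : ∀ (n : ℕ) (h : (Fin n → ℤˣ) → ℝ)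
    (_ : ∀ x i a, h (Function.update x i a) ≤ h x + 2),
    (∑ x, Real.exp (t * h x)) * (∑ x, Real.exp (-(t * h x))) ≤ (2 + 2 * Real.cosh (2 * t)) ^ n := by
  intro n
  induction n with
  | zero =>
    intro h _
    simp [← Real.exp_add]
  | succ n ih =>
    intro h hh
    rw [cons_sum, cons_sum]
    have key : ∀ a b : ℤˣ, ∑ x : Fin n → ℤˣ, Real.exp (t * h (Fin.cons a x)) ≤
        Real.exp (2 * t) * ∑ x : Fin n → ℤˣ, Real.exp (t * h (Fin.cons b x)) := by
      intro a b
      rw [Finset.mul_sum]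
      refine Finset.sum_le_sum fun x _ => ?_
      rw [← Real.exp_add]
      apply Real.exp_le_exp.2
      have := hh (Fin.cons b x) 0 a
      rw [Fin.update_cons_zero] at this
      nlinarith
    have hi : ∀ a : ℤˣ, (∑ x : Fin n → ℤˣ, Real.exp (t * h (Fin.cons a x))) *
        (∑ x : Fin n → ℤˣ, Real.exp (-(t * h (Fin.cons a x)))) ≤ (2 + 2 * Real.cosh (2 * t)) ^ n := by
      intro a
      refine ih (fun x => h (Fin.cons a x)) ?_
      intro x i c
      have := hh (Fin.cons a x) i.succ c
      rwa [← Fin.cons_update] at this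
    have k1 := key 1 (-1)
    have k2 := key (-1) 1
    have h1 := hi 1
    have h2 := hi (-1)
    have p1 : 0 < ∑ x : Fin n → ℤˣ, Real.exp (t * h (Fin.cons 1 x)) :=
      Finset.sum_pos (fun _ _ => Real.exp_pos _) Finset.univ_nonempty
    have p2 : 0 < ∑ x : Fin n → ℤˣ, Real.exp (t * h (Fin.cons (-1) x)) :=
      Finset.sum_pos (fun _ _ => Real.exp_pos _) Finset.univ_nonempty
    set a0 := ∑ x : Fin n → ℤˣ, Real.exp (t * h (Fin.cons 1 x))
    set a1 := ∑ x : Fin n → ℤˣ, Real.exp (t * h (Fin.cons (-1) x))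
    set b0 := ∑ x : Fin n → ℤˣ, Real.exp (-(t * h (Fin.cons 1 x)))
    set b1 := ∑ x : Fin n → ℤˣ, Real.exp (-(t * h (Fin.cons (-1) x)))
    set c := (2 + 2 * Real.cosh (2 * t)) ^ n
    have hc : 0 ≤ c := by have := Real.cosh_pos (2*t); positivity
    rw [pow_succ]
    change _ ≤ c * _
    have e1 : a0 * b1 ≤ a0 / a1 * c := by
      rw [div_mul_eq_mul_div, le_div_iff₀ p2]; nlinarith
    have e2 : a1 * b0 ≤ a1 / a0 * c := by
      rw [div_mul_eq_mul_div, le_div_iff₀ p1]; nlinarith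
    have e3 : a0 / a1 + a1 / a0 ≤ 2 * Real.cosh (2 * t) := by
      rw [Real.cosh_eq, div_add_div _ _ p2.ne' p1.ne', div_le_iff₀ (by positivity)]
      have hE : Real.exp (2*t) * Real.exp (-(2*t)) = 1 := by rw [← Real.exp_add]; simp
      have hp := Real.exp_pos (2*t)
      have hp' := Real.exp_pos (-(2*t))
      have : Real.exp (-(2*t)) * (Real.exp (2*t) * a1 - a0) * (Real.exp (2*t) * a0 - a1) ≥ 0 := by
        apply mul_nonneg (mul_nonneg hp'.le _) <;> linarith
      have h3 : Real.exp (-(2*t)) * (Real.exp (2*t) * a1 - a0) * (Real.exp (2*t) * a0 - a1)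
         = (Real.exp (2*t) * Real.exp (-(2*t))) * (Real.exp (2*t) * (a0 * a1)) - (Real.exp (2*t) * Real.exp (-(2*t))) * (a0*a0 + a1*a1) + Real.exp (-(2*t)) * (a0 * a1) := by ring
      rw [hE] at h3
      nlinarith
    have e4 := mul_le_mul_of_nonneg_right e3 hc
    nlinarith

lemma conc' (t : ℝ) (ht : 0 ≤ t) (n : ℕ) (h : (Fin n → ℤˣ) → ℝ)
    (hh : ∀ x i a, h (Function.update x i a) ≤ h x + 2) :
    (∑ x, Real.exp (t * h x)) * (∑ x, Real.exp (-(t * h x))) ≤ 2^n * 2^n * Real.exp (t^2 * n) := by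
  refine (conc t ht n h hh).trans ?_
  have h1 : 2 + 2 * Real.cosh (2 * t) ≤ 2 * 2 * Real.exp (t^2) := by
    have h2 := Real.cosh_le_exp_half_sq t
    have h3 := Real.cosh_pos t
    have h4 : Real.exp (t^2) = Real.exp (t^2/2) * Real.exp (t^2/2) := by
      rw [← Real.exp_add]; ring_nf
    rw [Real.cosh_two_mul, h4, Real.sinh_sq]
    nlinarith
  have h0 : 0 ≤ 2 + 2 * Real.cosh (2 * t) := by have := Real.cosh_pos (2*t); positivity
  refine (pow_le_pow_left₀ h0 h1 n).trans_eq ?_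
  rw [mul_pow, mul_pow, ← Real.exp_nat_mul]
  ring_nf

/-- average of the support function of a large subset of the cube -/
lemma width (t β : ℝ) (ht : 0 < t) (n : ℕ) (S : Finset (Fin n → ℤˣ)) (hS : S.Nonempty)
    (hcard : 2 ^ n * Real.exp (-(β * n)) ≤ (S.card : ℝ)) :
    2 ^ n * (n * (1 - t - β / t)) ≤
      ∑ σ : Fin n → ℤˣ, S.sup' hS (fun x => ∑ j, ((σ j : ℤ) : ℝ) * ((x j : ℤ) : ℝ)) := by
  set G : (Fin n → ℤˣ) → ℝ := fun σ => S.sup' hS (fun x => ∑ j, ((σ j : ℤ) : ℝ) * ((x j : ℤ) : ℝ)) with hG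
  have habs : ∀ a : ℤˣ, ((a : ℤ) : ℝ) = 1 ∨ ((a : ℤ) : ℝ) = -1 := by
    intro a; rcases Int.units_eq_one_or a with rfl | rfl <;> simp
  have hLip : ∀ x i a, G (Function.update x i a) ≤ G x + 2 := by
    intro x i a
    refine Finset.sup'_le _ _ fun z hz => ?_
    have h1 : ∑ j, ((x j : ℤ) : ℝ) * ((z j : ℤ) : ℝ) ≤ G x :=
      Finset.le_sup' (fun z : Fin n → ℤˣ => ∑ j, ((x j : ℤ) : ℝ) * ((z j : ℤ) : ℝ)) hz
    have h2 : ∑ j, (((Function.update x i a) j : ℤ) : ℝ) * ((z j : ℤ) : ℝ) ≤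
        ∑ j, (((x j : ℤ) : ℝ) * ((z j : ℤ) : ℝ) + if j = i then 2 else 0) := by
      refine Finset.sum_le_sum fun j _ => ?_
      by_cases hj : j = i
      · subst hj
        simp only [Function.update_self, if_true]
        rcases habs a with h | h <;> rcases habs (x j) with h' | h' <;> rcases habs (z j) with h'' | h'' <;>
          rw [h, h', h''] <;> norm_num
      · simp [hj]
    rw [Finset.sum_add_distrib] at h2
    simp at h2
    linarith
  have hc := conc' t ht.le n G hLip
  have hself : ∀ x ∈ S, (n : ℝ) ≤ G x := by
    intro x hx
    refine le_trans ?_ (Finset.le_sup' (fun z : Fin n → ℤˣ => ∑ j, ((x j : ℤ) : ℝ) * ((z j : ℤ) : ℝ)) hx)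
    have : ∀ j, ((x j : ℤ) : ℝ) * ((x j : ℤ) : ℝ) = 1 := by
      intro j; rcases habs (x j) with h | h <;> rw [h] <;> norm_num
    simp [this]
  have hA : (S.card : ℝ) * Real.exp (t * n) ≤ ∑ x, Real.exp (t * G x) := by
    calc (S.card : ℝ) * Real.exp (t * n) = ∑ x ∈ S, Real.exp (t * n) := by simp
      _ ≤ ∑ x ∈ S, Real.exp (t * G x) := Finset.sum_le_sum fun x hx =>
          Real.exp_le_exp.2 (mul_le_mul_of_nonneg_left (hself x hx) ht.le)
      _ ≤ _ := Finset.sum_le_sum_of_subset_of_nonneg (Finset.subset_univ _) (fun _ _ _ => (Real.exp_pos _).le)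
  set a : ℝ := (∑ x, G x) / 2 ^ n with ha
  have hsum : ∑ x, G x = 2 ^ n * a := by rw [ha]; field_simp
  have hB : 2 ^ n * Real.exp (-(t * a)) ≤ ∑ x, Real.exp (-(t * G x)) := by
    have : ∀ x, Real.exp (-(t*a)) * (1 + t * a - t * G x) ≤ Real.exp (-(t * G x)) := by
      intro x
      have h1 := Real.add_one_le_exp (t * a - t * G x)
      have h2 : Real.exp (-(t * G x)) = Real.exp (-(t*a)) * Real.exp (t * a - t * G x) := by
        rw [← Real.exp_add]; ring_nf
      rw [h2]
      exact mul_le_mul_of_nonneg_left (by linarith) (Real.exp_pos _).le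
    refine le_trans (le_of_eq ?_) (Finset.sum_le_sum fun x _ => this x)
    rw [← Finset.mul_sum, Finset.sum_sub_distrib, ← Finset.mul_sum, hsum]
    simp
    ring
  rw [hsum]
  have h2n : (0:ℝ) < 2 ^ n := by positivity
  refine mul_le_mul_of_nonneg_left ?_ h2n.le
  have hfin : (2 ^ n * Real.exp (-(β * n)) * Real.exp (t * n)) * (2 ^ n * Real.exp (-(t * a))) ≤ 2^n * 2^n * Real.exp (t^2 * n) := by
    refine le_trans (mul_le_mul ((mul_le_mul_of_nonneg_right hcard (Real.exp_pos _).le).trans hA) hB (by positivity) ?_) hc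
    exact Finset.sum_nonneg fun _ _ => (Real.exp_pos _).le
  have h5 : (2 ^ n * Real.exp (-(β * n)) * Real.exp (t * n)) * (2 ^ n * Real.exp (-(t * a))) = 2^n * 2^n * Real.exp (-(β * n) + t * n + -(t*a)) := by
    rw [Real.exp_add, Real.exp_add]; ring
  rw [h5] at hfin
  have h6 := Real.exp_le_exp.1 (le_of_mul_le_mul_left hfin (by positivity))
  have h7 : n * (1 - t - β / t) = (t * n - t^2 * n - β * n) / t := by field_simp
  rw [h7, div_le_iff₀ ht]
  linarith

lemma round_bound (z : ℝ) (q : ℝ) (hq : 1 ≤ q) : ((|round z| : ℤ) : ℝ) ≤ Real.exp (q * (2 * |z| - 1)) := by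
  have h1 := abs_sub_round z
  push_cast
  have h2 : |(round z : ℝ)| ≤ |z| + 1/2 := by
    have := abs_sub_abs_le_abs_sub (round z : ℝ) z
    rw [abs_sub_comm] at this
    linarith
  by_cases h : 2 * |z| < 1
  · have h3 : |round z| < 1 := by
      have : ((|round z| : ℤ) : ℝ) < 1 := by push_cast; linarith
      exact_mod_cast this
    have : round z = 0 := Int.abs_lt_one_iff.1 h3
    rw [this]; simp; positivity
  · push Not at h
    have h4 := Real.add_one_le_exp (2 * |z| - 1)
    have h5 : Real.exp (2 * |z| - 1) ≤ Real.exp (q * (2 * |z| - 1)) := Real.exp_le_exp.2 (by nlinarith)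
    linarith

lemma round_eq_bound (z w : ℝ) (h : round z = round w) : |z - w| ≤ 1 := by
  have h1 := abs_sub_round z
  have h2 := abs_sub_round w
  rw [h] at h1
  rw [abs_le] at *
  constructor <;> linarith [h1.1, h1.2, h2.1, h2.2]

lemma mgf_cube {n : ℕ} (θ : ℝ) (a : Fin n → ℝ) (ha : ∀ j, |a j| ≤ 1) :
    ∑ x : Fin n → ℤˣ, Real.exp (θ * ∑ j, a j * ((x j : ℤ) : ℝ)) ≤ 2 ^ n * Real.exp (θ ^ 2 / 2 * n) := by
  have h1 : ∀ x : Fin n → ℤˣ, Real.exp (θ * ∑ j, a j * ((x j : ℤ) : ℝ)) =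
      ∏ j, Real.exp (θ * (a j * ((x j : ℤ) : ℝ))) := by
    intro x; rw [Finset.mul_sum, Real.exp_sum]
  simp_rw [h1]
  rw [← Fintype.prod_sum (fun j (u : ℤˣ) => Real.exp (θ * (a j * ((u : ℤ) : ℝ))))]
  have h2 : ∀ j, ∑ u : ℤˣ, Real.exp (θ * (a j * ((u : ℤ) : ℝ))) ≤ 2 * Real.exp (θ^2/2) := by
    intro j
    rw [units_sum]
    have := Real.cosh_le_exp_half_sq (θ * a j)
    rw [Real.cosh_eq] at this
    have h3 : Real.exp ((θ * a j)^2/2) ≤ Real.exp (θ^2/2) := by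
      apply Real.exp_le_exp.2
      have : (a j)^2 ≤ 1 := by rw [← sq_abs]; have := abs_nonneg (a j); nlinarith [ha j]
      rw [mul_pow]; nlinarith [sq_nonneg θ]
    simp
    linarith
  refine (Finset.prod_le_prod (fun j _ => Finset.sum_nonneg fun _ _ => (Real.exp_pos _).le) fun j _ => h2 j).trans_eq ?_
  simp [mul_pow, ← Real.exp_nat_mul]
  ring_nf

lemma round_sum {n : ℕ} (T : ℝ) (hT : 0 < T) (hn : 0 < n) (hq : 1 ≤ T ^ 2 / n) (a : Fin n → ℝ) (ha : ∀ j, |a j| ≤ 1) :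
    ∑ x : Fin n → ℤˣ, ((|round ((∑ j, a j * ((x j : ℤ) : ℝ)) / (2 * T))| : ℤ) : ℝ) ≤
      2 * 2 ^ n * Real.exp (- (T^2 / n / 2)) := by
  have hn' : (0:ℝ) < n := by exact_mod_cast hn
  have h1 : ∀ x : Fin n → ℤˣ, ((|round ((∑ j, a j * ((x j : ℤ) : ℝ)) / (2 * T))| : ℤ) : ℝ) ≤
      Real.exp (-(T^2/n)) * (Real.exp ((T/n) * ∑ j, a j * ((x j : ℤ) : ℝ)) +
        Real.exp ((-(T/n)) * ∑ j, a j * ((x j : ℤ) : ℝ))) := by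
    intro x
    set X := ∑ j, a j * ((x j : ℤ) : ℝ)
    refine (round_bound _ _ hq).trans ?_
    rw [mul_add, ← Real.exp_add, ← Real.exp_add]
    have h2 : T^2/n * (2 * |X / (2*T)| - 1) = -(T^2/n) + T/n * |X| := by
      rw [abs_div, abs_of_pos (by positivity : 0 < 2 * T)]; field_simp; ring
    rw [h2]
    rcases abs_cases X with ⟨h, _⟩ | ⟨h, _⟩ <;> rw [h]
    · have := Real.exp_pos (-(T^2/n) + -(T/n) * X); linarith
    · have := Real.exp_pos (-(T^2/n) + (T/n) * X)
      rw [show T / n * -X = -(T/n) * X by ring]; linarith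
  refine (Finset.sum_le_sum fun x _ => h1 x).trans ?_
  rw [← Finset.mul_sum, Finset.sum_add_distrib]
  have m1 := mgf_cube (T/n) a ha
  have m2 := mgf_cube (-(T/n)) a ha
  rw [neg_sq] at m2
  have h3 : Real.exp (- (T^2 / n / 2)) = Real.exp (-(T^2/n)) * Real.exp ((T/n)^2/2*n) := by
    rw [← Real.exp_add]; congr 1; field_simp; ring
  rw [h3]
  have := mul_le_mul_of_nonneg_left (add_le_add m1 m2) (Real.exp_pos (-(T^2/n))).le
  refine this.trans_eq ?_
  ring

lemma geom_sum_bound (r : ℝ) (h0 : 0 ≤ r) (h1 : r ≤ 1/2) (N : ℕ) :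
    ∑ k ∈ Finset.Icc (-(N:ℤ)) N, r ^ k.natAbs ≤ 1 + 4 * r := by
  have key : ∑ k ∈ Finset.Icc (-(N:ℤ)) N, r ^ k.natAbs ≤ 1 + 4 * r - 4 * r ^ (N+1) := by
    induction N with
    | zero => simp
    | succ N ih =>
      have : Finset.Icc (-((N+1 : ℕ):ℤ)) ((N+1 : ℕ):ℤ) = insert (-((N+1 : ℕ):ℤ)) (insert ((N+1:ℕ):ℤ) (Finset.Icc (-(N:ℤ)) N)) := by
        ext k; simp only [Finset.mem_Icc, Finset.mem_insert]; push_cast; omega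
      rw [this, Finset.sum_insert, Finset.sum_insert]
      · have e1 : (-((N+1 : ℕ):ℤ)).natAbs = N+1 := by omega
        have e2 : (((N+1 : ℕ):ℤ)).natAbs = N+1 := by omega
        rw [e1, e2]
        have : r ^ (N+1+1) ≤ r^(N+1) * (1/2) := by
          rw [pow_succ]; exact mul_le_mul_of_nonneg_left h1 (by positivity)
        linarith
      · simp
      · simp only [Finset.mem_insert, Finset.mem_Icc]; push_cast; omega
  have : 0 ≤ r^(N+1) := by positivity
  linarith

lemma count_bound {m : ℕ} (B : Finset (Fin m → ℤ)) (R s : ℝ) (hs : Real.exp (-s) ≤ 1/2) (hs0 : 0 ≤ s)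
    (hB : ∀ b ∈ B, ((∑ i, |b i| : ℤ) : ℝ) ≤ R) :
    (B.card : ℝ) ≤ Real.exp (s * R + 4 * m * Real.exp (-s)) := by
  set r := Real.exp (-s) with hr
  have hr0 : 0 < r := Real.exp_pos _
  obtain ⟨N, hN⟩ : ∃ N : ℕ, ∀ b ∈ B, ∀ i, b i ∈ Finset.Icc (-(N:ℤ)) N := by
    refine ⟨⌈R⌉₊, fun b hb i => ?_⟩
    have h1 : |b i| ≤ ∑ i, |b i| := Finset.single_le_sum (f := fun i => |b i|) (fun _ _ => abs_nonneg _) (Finset.mem_univ i)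
    have h2 : ((|b i| : ℤ) : ℝ) ≤ ((⌈R⌉₊ : ℤ) : ℝ) := by
      refine le_trans (by exact_mod_cast h1) ((hB b hb).trans ?_)
      exact_mod_cast Nat.le_ceil R
    have h3 : |b i| ≤ (⌈R⌉₊ : ℤ) := by exact_mod_cast h2
    rw [Finset.mem_Icc]; exact abs_le.1 h3
  have h1 : ∀ b ∈ B, (1:ℝ) ≤ Real.exp (s * R) * ∏ i, r ^ (b i).natAbs := by
    intro b hb
    have : ∏ i, r ^ (b i).natAbs = Real.exp (-(s * ((∑ i, |b i| : ℤ) : ℝ))) := by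
      push_cast
      rw [Finset.mul_sum, ← Finset.sum_neg_distrib, Real.exp_sum]
      refine Finset.prod_congr rfl fun i _ => ?_
      rw [hr, ← Real.exp_nat_mul]
      congr 1
      rw [Nat.cast_natAbs]; push_cast; ring
    rw [this, ← Real.exp_add]
    apply Real.one_le_exp
    have := mul_le_mul_of_nonneg_left (hB b hb) hs0
    linarith
  calc (B.card : ℝ) = ∑ b ∈ B, (1:ℝ) := by simp
    _ ≤ ∑ b ∈ B, Real.exp (s * R) * ∏ i, r ^ (b i).natAbs := Finset.sum_le_sum h1
    _ ≤ ∑ b ∈ Fintype.piFinset (fun _ : Fin m => Finset.Icc (-(N:ℤ)) N), Real.exp (s * R) * ∏ i, r ^ (b i).natAbs := by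
        apply Finset.sum_le_sum_of_subset_of_nonneg
        · intro b hb; rw [Fintype.mem_piFinset]; exact hN b hb
        · intros; positivity
    _ = Real.exp (s * R) * ∏ i : Fin m, ∑ k ∈ Finset.Icc (-(N:ℤ)) N, r ^ k.natAbs := by
        rw [← Finset.mul_sum, Finset.prod_univ_sum]
    _ ≤ Real.exp (s * R) * ∏ i : Fin m, Real.exp (4 * r) := by
        refine mul_le_mul_of_nonneg_left (Finset.prod_le_prod (fun _ _ => Finset.sum_nonneg fun _ _ => by positivity) fun i _ => ?_) (Real.exp_pos _).le
        refine (geom_sum_bound r hr0.le hs N).trans ?_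
        have := Real.add_one_le_exp (4 * r); linarith
    _ = _ := by
        simp only [Finset.prod_const, Finset.card_univ, Fintype.card_fin]
        rw [← Real.exp_nat_mul, ← Real.exp_add]; ring_nf

lemma pigeon (m n : ℕ) (hn : 0 < n) (A : Matrix (Fin m) (Fin n) ℝ) (hA : ∀ i j, |A i j| ≤ 1)
    (K β : ℝ) (hβ : 0 < β) (hK4 : 4 ≤ K) (hK : 48 / β ≤ K) (hnβ : 2 / β ≤ n) :
    ∃ S : Finset (Fin n → ℤˣ), S.Nonempty ∧ 2 ^ n * Real.exp (-(β * n)) ≤ (S.card : ℝ) ∧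
      ∀ x ∈ S, ∀ y ∈ S, ∀ i, |∑ j, A i j * ((x j : ℤ) : ℝ) - ∑ j, A i j * ((y j : ℤ) : ℝ)| ≤
        2 * (K * Real.sqrt ((n : ℝ) * Real.log ((m : ℝ) / (n : ℝ) + 2))) := by
  have hn' : (0:ℝ) < n := by exact_mod_cast hn
  set L := Real.log ((m : ℝ) / (n : ℝ) + 2) with hL
  have hL2 : 1/2 ≤ L := by
    have h1 : Real.log 2 ≤ L := Real.log_le_log (by norm_num) (by have : 0 ≤ (m:ℝ)/n := by positivity
                                                                  linarith)
    have := Real.log_two_gt_d9; linarith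
  have hexpL : Real.exp L = (m:ℝ)/n + 2 := Real.exp_log (by positivity)
  have hm : (m:ℝ) ≤ n * Real.exp L := by rw [hexpL]; field_simp; linarith
  set T := K * Real.sqrt (n * L) with hT
  have hTpos : 0 < T := by
    have : 0 < Real.sqrt (n * L) := Real.sqrt_pos.2 (by positivity)
    positivity
  have hT2 : T^2 / n = K^2 * L := by
    rw [hT, mul_pow, Real.sq_sqrt (by positivity)]; field_simp
  have hq : 1 ≤ T^2/n := by rw [hT2]; nlinarith
  set b : (Fin n → ℤˣ) → (Fin m → ℤ) := fun x i => round ((∑ j, A i j * ((x j : ℤ) : ℝ)) / (2 * T)) with hb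
  set W : (Fin n → ℤˣ) → ℝ := fun x => ((∑ i, |b x i| : ℤ) : ℝ) with hW
  have hWn : ∀ x, 0 ≤ W x := fun x => by
    have : (0:ℤ) ≤ ∑ i, |b x i| := Finset.sum_nonneg fun _ _ => abs_nonneg _
    show (0:ℝ) ≤ ((∑ i, |b x i| : ℤ) : ℝ)
    exact Int.cast_nonneg this
  have hWsum : ∑ x, W x ≤ m * (2 * 2^n * Real.exp (-(K^2 * L / 2))) := by
    have e : ∀ x, W x = ∑ i, ((|b x i| : ℤ) : ℝ) := fun x => by simp only [hW]; push_cast; rfl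
    simp_rw [e]
    rw [Finset.sum_comm]
    have := Finset.sum_le_sum fun (i : Fin m) (_ : i ∈ Finset.univ) => round_sum T hTpos hn hq (A i) (hA i)
    rw [hT2] at this
    simpa using this
  set R := 4 * n * Real.exp (L - K^2 * L / 2) with hR
  have hRpos : 0 < R := by positivity
  have hWsum2 : ∑ x, W x ≤ 2^n * R / 2 := by
    refine hWsum.trans ?_
    have h1 := mul_le_mul_of_nonneg_right hm (by positivity : 0 ≤ 2 * 2^n * Real.exp (-(K^2 * L / 2)))
    refine h1.trans_eq ?_
    rw [hR, sub_eq_add_neg, Real.exp_add]; ring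
  set Ωg := Finset.univ.filter (fun x => W x ≤ R) with hΩ
  have hΩc : (2:ℝ)^n / 2 ≤ (Ωg.card : ℝ) := by
    have h1 : (∑ x : Fin n → ℤˣ, (1 - W x / R)) ≤ ∑ x : Fin n → ℤˣ, if W x ≤ R then (1:ℝ) else 0 := by
      refine Finset.sum_le_sum fun x _ => ?_
      split_ifs with h
      · have : 0 ≤ W x / R := div_nonneg (hWn x) hRpos.le
        linarith
      · have : 1 ≤ W x / R := (one_le_div hRpos).2 (le_of_not_ge h)
        linarith
    rw [Finset.sum_sub_distrib, ← Finset.sum_div, Finset.sum_boole] at h1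
    have h2 : (∑ x, W x) / R ≤ 2^n/2 := by rw [div_le_iff₀ hRpos]; linarith
    simp only [Finset.sum_const, Finset.card_univ, card_cube, nsmul_eq_mul, mul_one] at h1
    push_cast at h1
    change _ ≤ (Ωg.card : ℝ) at h1
    linarith
  have hs : Real.exp (-(K * L)) ≤ 1/2 := by
    rw [Real.exp_neg, inv_le_comm₀ (Real.exp_pos _) (by norm_num)]
    have := Real.add_one_le_exp (K * L)
    nlinarith
  have hcount := count_bound (Ωg.image b) R (K * L) hs (by positivity) (by
    intro c hc
    obtain ⟨x, hx, rfl⟩ := Finset.mem_image.1 hc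
    exact (Finset.mem_filter.1 hx).2)
  -- numerics
  set E := Real.exp (-((K-1) * L)) with hE
  have hEpos : 0 < E := Real.exp_pos _
  have hE2 : E * (K + 1) ≤ 2 := by
    rw [hE, Real.exp_neg, inv_mul_le_iff₀ (Real.exp_pos _)]
    have := Real.add_one_le_exp ((K-1) * L)
    nlinarith
  have hnum1 : 4 * m * Real.exp (-(K*L)) ≤ 4 * n * E := by
    have : Real.exp L * Real.exp (-(K*L)) = E := by rw [← Real.exp_add, hE]; ring_nf
    have h1 := mul_le_mul_of_nonneg_right hm (Real.exp_pos (-(K*L))).le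
    rw [mul_assoc (n:ℝ), this] at h1
    linarith
  have hnum2 : K * L * R ≤ 8 * n * E := by
    have h1 : L ≤ Real.exp L := by have := Real.add_one_le_exp L; linarith
    have h2 : L * Real.exp (L - K^2*L/2) ≤ E * E := by
      refine (mul_le_mul_of_nonneg_right h1 (Real.exp_pos _).le).trans ?_
      rw [← Real.exp_add, hE, ← Real.exp_add]
      apply Real.exp_le_exp.2
      have : 0 ≤ L * (K * (K - 4)) := by
        have : 0 ≤ K - 4 := by linarith
        positivity
      nlinarith
    have h3 : K * L * R = 4 * n * K * (L * Real.exp (L - K^2*L/2)) := by rw [hR]; ring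
    rw [h3]
    refine (mul_le_mul_of_nonneg_left h2 (by positivity)).trans ?_
    have h4 : K * E ≤ 2 := by nlinarith
    have h5 : 4 * n * K * (E * E) = 4 * n * E * (K * E) := by ring
    rw [h5]
    have := mul_le_mul_of_nonneg_left h4 (by positivity : 0 ≤ 4 * n * E)
    linarith
  have hEβ : 12 * E ≤ β / 2 := by
    rw [div_le_iff₀ hβ] at hK
    have : 48 * E ≤ 2 * β := by
      calc 48 * E ≤ K * β * E := by gcongr
        _ = β * (K * E) := by ring
        _ ≤ β * 2 := by apply mul_le_mul_of_nonneg_left _ hβ.le; nlinarith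
        _ = _ := by ring
    linarith
  have hcount2 : ((Ωg.image b).card : ℝ) ≤ Real.exp (β * n / 2) := by
    refine hcount.trans (Real.exp_le_exp.2 ?_)
    have := mul_le_mul_of_nonneg_left hEβ hn'.le
    linarith
  have hhalf : Real.exp (-(β * n / 2)) ≤ 1/2 := by
    rw [Real.exp_neg, inv_le_comm₀ (Real.exp_pos _) (by norm_num)]
    have := Real.add_one_le_exp (β * n / 2)
    rw [div_le_iff₀ hβ] at hnβ
    linarith
  have hΩne : Ωg.Nonempty := by
    rw [← Finset.card_pos]
    have : (0:ℝ) < Ωg.card := lt_of_lt_of_le (by positivity) hΩc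
    exact_mod_cast this
  obtain ⟨c, hc, hcc⟩ : ∃ c ∈ Ωg.image b, 2 ^ n * Real.exp (-(β * n)) ≤ ((Ωg.filter (fun x => b x = c)).card : ℝ) := by
    by_contra hcon
    push Not at hcon
    have h1 : (Ωg.card : ℝ) = ∑ c ∈ Ωg.image b, ((Ωg.filter (fun x => b x = c)).card : ℝ) := by
      rw [Finset.card_eq_sum_card_image b Ωg]; push_cast; rfl
    have h2 : (Ωg.card : ℝ) < ∑ c ∈ Ωg.image b, 2 ^ n * Real.exp (-(β * n)) := by
      rw [h1]; exact Finset.sum_lt_sum_of_nonempty (hΩne.image b) hcon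
    rw [Finset.sum_const, nsmul_eq_mul] at h2
    have h3 : ((Ωg.image b).card : ℝ) * (2 ^ n * Real.exp (-(β * n))) ≤ 2^n * Real.exp (-(β * n / 2)) := by
      refine (mul_le_mul_of_nonneg_right hcount2 (by positivity)).trans_eq ?_
      rw [mul_left_comm, ← Real.exp_add]; ring_nf
    have h4 := mul_le_mul_of_nonneg_left hhalf (by positivity : (0:ℝ) ≤ 2^n)
    linarith
  refine ⟨Ωg.filter (fun x => b x = c), ?_, hcc, ?_⟩
  · rw [← Finset.card_pos]
    have : (0:ℝ) < (Ωg.filter (fun x => b x = c)).card := lt_of_lt_of_le (by positivity) hcc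
    exact_mod_cast this
  · intro x hx y hy i
    have hx' := (Finset.mem_filter.1 hx).2
    have hy' := (Finset.mem_filter.1 hy).2
    have := round_eq_bound _ _ (congrFun (hx'.trans hy'.symm) i)
    rw [← sub_div, abs_div, abs_of_pos (by positivity : 0 < 2 * T), div_le_one (by positivity)] at this
    exact this

/-- support function of `Gamma` -/
noncomputable def FF (m n : ℕ) (A : Matrix (Fin m) (Fin n) ℝ) (C : ℝ) (g : Fin n → ℝ) : ℝ :=
  sSup {t | ∃ y ∈ Gamma m n A C, t = ∑ j, g j * y j}

lemma ff_elt {m n : ℕ} {A : Matrix (Fin m) (Fin n) ℝ} {C : ℝ} (g : Fin n → ℝ) {y : Fin n → ℝ}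
    (hy : y ∈ Gamma m n A C) : ∑ j, g j * y j ≤ ∑ j, |g j| := by
  refine Finset.sum_le_sum fun j _ => ?_
  refine (le_abs_self _).trans ?_
  rw [abs_mul]
  exact mul_le_of_le_one_right (abs_nonneg _) (hy.1 j)

lemma ff_bdd (m n : ℕ) (A : Matrix (Fin m) (Fin n) ℝ) (C : ℝ) (g : Fin n → ℝ) :
    BddAbove {t | ∃ y ∈ Gamma m n A C, t = ∑ j, g j * y j} := by
  refine ⟨∑ j, |g j|, ?_⟩
  rintro t ⟨y, hy, rfl⟩
  exact ff_elt g hy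

lemma gamma_zero (m n : ℕ) (A : Matrix (Fin m) (Fin n) ℝ) (C : ℝ) (hC : 0 ≤ C) :
    (0 : Fin n → ℝ) ∈ Gamma m n A C := by
  refine ⟨by simp, fun i => ?_⟩
  simp only [Matrix.mulVec_zero, Pi.zero_apply, abs_zero]
  positivity

lemma ff_ne (m n : ℕ) (A : Matrix (Fin m) (Fin n) ℝ) (C : ℝ) (hC : 0 ≤ C) (g : Fin n → ℝ) :
    {t | ∃ y ∈ Gamma m n A C, t = ∑ j, g j * y j}.Nonempty :=
  ⟨_, 0, gamma_zero m n A C hC, rfl⟩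

lemma le_ff {m n : ℕ} {A : Matrix (Fin m) (Fin n) ℝ} {C : ℝ} (g : Fin n → ℝ) {y : Fin n → ℝ}
    (hy : y ∈ Gamma m n A C) : ∑ j, g j * y j ≤ FF m n A C g :=
  le_csSup (ff_bdd m n A C g) ⟨y, hy, rfl⟩

lemma ff_le {m n : ℕ} {A : Matrix (Fin m) (Fin n) ℝ} {C : ℝ} (hC : 0 ≤ C) (g : Fin n → ℝ) (b : ℝ)
    (h : ∀ y ∈ Gamma m n A C, ∑ j, g j * y j ≤ b) : FF m n A C g ≤ b := by
  refine csSup_le (ff_ne m n A C hC g) ?_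
  rintro t ⟨y, hy, rfl⟩
  exact h y hy

lemma ff_nonneg {m n : ℕ} {A : Matrix (Fin m) (Fin n) ℝ} {C : ℝ} (hC : 0 ≤ C) (g : Fin n → ℝ) :
    0 ≤ FF m n A C g := by
  have := le_ff g (gamma_zero m n A C hC)
  simpa using this

lemma ff_upper {m n : ℕ} {A : Matrix (Fin m) (Fin n) ℝ} {C : ℝ} (hC : 0 ≤ C) (g : Fin n → ℝ) :
    FF m n A C g ≤ ∑ j, |g j| := ff_le hC g _ fun _ hy => ff_elt g hy

lemma ff_sub {m n : ℕ} {A : Matrix (Fin m) (Fin n) ℝ} {C : ℝ} (hC : 0 ≤ C) (g h : Fin n → ℝ) :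
    FF m n A C g ≤ FF m n A C h + ∑ j, |g j - h j| := by
  refine ff_le hC g _ fun y hy => ?_
  have h1 := le_ff h hy
  have h2 := ff_elt (fun j => g j - h j) hy
  have h3 : ∑ j, g j * y j = ∑ j, h j * y j + ∑ j, (g j - h j) * y j := by
    rw [← Finset.sum_add_distrib]; exact Finset.sum_congr rfl fun _ _ => by ring
  linarith

lemma ff_cont {m n : ℕ} {A : Matrix (Fin m) (Fin n) ℝ} {C : ℝ} (hC : 0 ≤ C) :
    Continuous (FF m n A C) := by
  refine (LipschitzWith.of_dist_le_mul (K := (n : NNReal)) fun g h => ?_).continuous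
  have h1 : ∑ j, |g j - h j| ≤ n * dist g h := by
    calc ∑ j, |g j - h j| ≤ ∑ j : Fin n, dist g h := Finset.sum_le_sum fun j _ => dist_le_pi_dist g h j
      _ = _ := by simp
  have h2 := ff_sub (A := A) hC g h
  have h3 := ff_sub (A := A) hC h g
  simp_rw [abs_sub_comm (h _)] at h3
  rw [Real.dist_eq, abs_le]
  push_cast
  constructor <;> linarith

lemma ff_concave {m n : ℕ} {A : Matrix (Fin m) (Fin n) ℝ} {a b l : ℝ} (ha : 0 ≤ a) (hb : 0 ≤ b)
    (hl : 0 ≤ l) (hl1 : l ≤ 1) (g : Fin n → ℝ) :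
    l * FF m n A a g + (1 - l) * FF m n A b g ≤ FF m n A (l * a + (1 - l) * b) g := by
  have hl' : 0 ≤ 1 - l := by linarith
  have key : ∀ y ∈ Gamma m n A a, ∀ z ∈ Gamma m n A b,
      l * (∑ j, g j * y j) + (1 - l) * (∑ j, g j * z j) ≤ FF m n A (l * a + (1 - l) * b) g := by
    intro y hy z hz
    have hmem : (l • y + (1 - l) • z) ∈ Gamma m n A (l * a + (1 - l) * b) := by
      constructor
      · intro j
        simp only [Pi.add_apply, Pi.smul_apply, smul_eq_mul]
        refine (abs_add_le _ _).trans ?_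
        rw [abs_mul, abs_mul, abs_of_nonneg hl, abs_of_nonneg hl']
        nlinarith [hy.1 j, hz.1 j]
      · intro i
        rw [Matrix.mulVec_add, Matrix.mulVec_smul, Matrix.mulVec_smul]
        simp only [Pi.add_apply, Pi.smul_apply, smul_eq_mul]
        refine (abs_add_le _ _).trans ?_
        rw [abs_mul, abs_mul, abs_of_nonneg hl, abs_of_nonneg hl']
        have h1 := mul_le_mul_of_nonneg_left (hy.2 i) hl
        have h2 := mul_le_mul_of_nonneg_left (hz.2 i) hl'
        linarith
    refine le_trans (le_of_eq ?_) (le_ff g hmem)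
    rw [Finset.mul_sum, Finset.mul_sum, ← Finset.sum_add_distrib]
    refine Finset.sum_congr rfl fun j _ => ?_
    simp only [Pi.add_apply, Pi.smul_apply, smul_eq_mul]; ring
  rcases hl.eq_or_lt with h0 | h0
  · subst h0; simp
  rcases hl'.eq_or_lt with h1 | h1
  · have : l = 1 := by linarith
    subst this; simp
  have s1 : ∀ z ∈ Gamma m n A b, FF m n A a g ≤
      (FF m n A (l * a + (1 - l) * b) g - (1 - l) * (∑ j, g j * z j)) / l := by
    intro z hz
    refine ff_le ha g _ fun y hy => ?_
    rw [le_div_iff₀ h0]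
    have := key y hy z hz
    linarith
  have s2 : FF m n A b g ≤ (FF m n A (l * a + (1 - l) * b) g - l * FF m n A a g) / (1 - l) := by
    refine ff_le hb g _ fun z hz => ?_
    have := s1 z hz
    rw [le_div_iff₀ h0] at this
    rw [le_div_iff₀ h1]
    linarith
  rw [le_div_iff₀ h1] at s2
  linarith

/-- standard Gaussian on `ℝ^n` -/
noncomputable abbrev gam (n : ℕ) : Measure (Fin n → ℝ) := Measure.pi fun _ : Fin n => gaussianReal 0 1

/-- first absolute moment -/
noncomputable def kap : ℝ := ∫ x, |x| ∂(gaussianReal 0 1)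

lemma int_sq : Integrable (fun x : ℝ => x ^ 2) (gaussianReal 0 1) := by
  have := memLp_id_gaussianReal (μ := 0) (v := 1) 2
  exact (this.integrable_sq)

lemma int_abs : Integrable (fun x : ℝ => |x|) (gaussianReal 0 1) := by
  have := memLp_id_gaussianReal (μ := 0) (v := 1) 1
  have h2 := (memLp_one_iff_integrable.1 (by simpa using this))
  exact h2.abs

lemma kap_le : kap ≤ 1 := by
  have hv : ∫ x, x ^ 2 ∂(gaussianReal 0 1) = 1 := by
    have h1 := variance_fun_id_gaussianReal (μ := 0) (v := 1)
    rw [variance_eq_integral (by fun_prop)] at h1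
    simpa using h1
  have h1 : kap ≤ ∫ x, (1 + x^2) / 2 ∂(gaussianReal 0 1) := by
    refine integral_mono int_abs (((integrable_const 1).add int_sq).div_const 2) fun x => ?_
    show |x| ≤ (1 + x^2)/2
    have := sq_nonneg (|x| - 1)
    rw [← sq_abs x]; linarith
  rw [integral_div, integral_add (integrable_const 1) int_sq, hv] at h1
  simp at h1
  linarith

lemma kap_nonneg : 0 ≤ kap := integral_nonneg fun _ => abs_nonneg _

lemma int_abs_coord {n : ℕ} (j : Fin n) : Integrable (fun g : Fin n → ℝ => |g j|) (gam n) := 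
  (measurePreserving_eval (fun _ : Fin n => gaussianReal 0 1) j).integrable_comp_of_integrable int_abs

lemma integral_abs_coord {n : ℕ} (j : Fin n) : ∫ g, |g j| ∂(gam n) = kap := by
  have h := measurePreserving_eval (fun _ : Fin n => gaussianReal 0 1) j
  have := integral_map (μ := gam n) (φ := Function.eval j) h.measurable.aemeasurable (f := fun x : ℝ => |x|)
    (by fun_prop)
  rw [h.map_eq] at this
  exact this.symm

lemma ff_int {m n : ℕ} {A : Matrix (Fin m) (Fin n) ℝ} {C : ℝ} (hC : 0 ≤ C) :
    Integrable (FF m n A C) (gam n) := by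
  refine Integrable.mono' (integrable_finsetSum Finset.univ fun j _ => int_abs_coord j)
    (ff_cont hC).aestronglyMeasurable (Filter.Eventually.of_forall fun g => ?_)
  rw [Real.norm_eq_abs, abs_of_nonneg (ff_nonneg hC g)]
  exact ff_upper hC g

lemma ff_integral_upper {m n : ℕ} {A : Matrix (Fin m) (Fin n) ℝ} {C : ℝ} (hC : 0 ≤ C) :
    ∫ g, FF m n A C g ∂(gam n) ≤ n * kap := by
  refine (integral_mono (ff_int hC) (integrable_finsetSum Finset.univ fun j _ => int_abs_coord j) fun g => ff_upper hC g).trans_eq ?_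
  rw [integral_finsetSum _ fun j _ => int_abs_coord j]
  simp [integral_abs_coord]

/-- sign flip -/
def flip' {n : ℕ} (σ : Fin n → ℤˣ) (g : Fin n → ℝ) : Fin n → ℝ := fun j => ((σ j : ℤ) : ℝ) * g j

lemma flip_mp {n : ℕ} (σ : Fin n → ℤˣ) : MeasurePreserving (flip' σ) (gam n) (gam n) := by
  refine measurePreserving_pi (fun _ : Fin n => gaussianReal 0 1) (fun _ : Fin n => gaussianReal 0 1) (f := fun j x => ((σ j : ℤ) : ℝ) * x) fun j => ?_
  refine ⟨by fun_prop, ?_⟩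
  rw [gaussianReal_map_const_mul]
  congr 1
  · simp
  · ext
    rcases Int.units_eq_one_or (σ j) with h | h <;> simp [h]

lemma flip_int {m n : ℕ} {A : Matrix (Fin m) (Fin n) ℝ} {C : ℝ} (hC : 0 ≤ C) (σ : Fin n → ℤˣ) :
    Integrable (fun g => FF m n A C (flip' σ g)) (gam n) :=
  (flip_mp σ).integrable_comp_of_integrable (ff_int hC)

lemma flip_integral {m n : ℕ} {A : Matrix (Fin m) (Fin n) ℝ} {C : ℝ} (hC : 0 ≤ C) (σ : Fin n → ℤˣ) :
    ∫ g, FF m n A C (flip' σ g) ∂(gam n) = ∫ g, FF m n A C g ∂(gam n) := by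
  have h := flip_mp σ
  have := integral_map (μ := gam n) h.measurable.aemeasurable (f := FF m n A C)
    (ff_cont hC).aestronglyMeasurable
  rw [h.map_eq] at this
  exact this.symm

lemma ff_integral_lower (m n : ℕ) (hn : 0 < n) (A : Matrix (Fin m) (Fin n) ℝ) (hA : ∀ i j, |A i j| ≤ 1)
    (K t : ℝ) (ht : 0 < t) (hK4 : 4 ≤ K) (hK : 48 / t^2 ≤ K) (hnβ : 2 / t^2 ≤ n) :
    n * kap * (1 - 2 * t) ≤ ∫ g, FF m n A K g ∂(gam n) := by
  have hK0 : 0 ≤ K := by linarith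
  obtain ⟨S, hS, hcard, hpair⟩ := pigeon m n hn A hA K (t^2) (by positivity) hK4 hK hnβ
  have hw := width t (t^2) ht n S hS hcard
  have habs : ∀ a : ℤˣ, ((a : ℤ) : ℝ) = 1 ∨ ((a : ℤ) : ℝ) = -1 := by
    intro a; rcases Int.units_eq_one_or a with rfl | rfl <;> simp
  have hex : ∀ σ : Fin n → ℤˣ, ∃ x ∈ S, S.sup' hS (fun x => ∑ j, ((σ j : ℤ) : ℝ) * ((x j : ℤ) : ℝ)) =
      ∑ j, ((σ j : ℤ) : ℝ) * ((x j : ℤ) : ℝ) := fun σ => Finset.exists_mem_eq_sup' hS _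
  choose X hXS hX using hex
  simp_rw [hX] at hw
  have hmem : ∀ σ : Fin n → ℤˣ, (fun j => (((X σ j : ℤ) : ℝ) - ((X (-σ) j : ℤ) : ℝ)) / 2) ∈ Gamma m n A K := by
    intro σ
    constructor
    · intro j
      rcases habs (X σ j) with h | h <;> rcases habs (X (-σ) j) with h' | h' <;> simp only [h, h'] <;> norm_num
    · intro i
      have h1 := hpair _ (hXS σ) _ (hXS (-σ)) i
      have h2 : A.mulVec (fun j => (((X σ j : ℤ) : ℝ) - ((X (-σ) j : ℤ) : ℝ)) / 2) i =
          (∑ j, A i j * ((X σ j : ℤ) : ℝ) - ∑ j, A i j * ((X (-σ) j : ℤ) : ℝ)) / 2 := by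
        rw [← Finset.sum_sub_distrib, Finset.sum_div]
        show ∑ j, A i j * ((((X σ j : ℤ) : ℝ) - ((X (-σ) j : ℤ) : ℝ)) / 2) = _
        exact Finset.sum_congr rfl fun j _ => by ring
      rw [h2, abs_div, abs_two]
      linarith
  -- pointwise bound
  have hpt : ∀ g : Fin n → ℝ, ∑ j, |g j| * ∑ σ : Fin n → ℤˣ, ((σ j : ℤ) : ℝ) * ((X σ j : ℤ) : ℝ) ≤
      ∑ σ, FF m n A K (flip' σ g) := by
    intro g
    set τ : Fin n → ℤˣ := fun j => if 0 ≤ g j then 1 else -1 with hτ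
    have hτg : ∀ j, ((τ j : ℤ) : ℝ) * g j = |g j| := by
      intro j
      simp only [hτ]
      split_ifs with h
      · simp [abs_of_nonneg h]
      · simp [abs_of_neg (lt_of_not_ge h)]
    rw [← Equiv.sum_comp (Equiv.mulRight τ) (fun σ => FF m n A K (flip' σ g))]
    have hfl : ∀ σ : Fin n → ℤˣ, flip' (Equiv.mulRight τ σ) g = fun j => ((σ j : ℤ) : ℝ) * |g j| := by
      intro σ; ext j
      simp only [flip', Equiv.coe_mulRight, Pi.mul_apply, Units.val_mul, Int.cast_mul]
      rw [mul_assoc, hτg]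
    simp_rw [hfl]
    have h1 : ∀ σ : Fin n → ℤˣ, (∑ j, ((σ j : ℤ) : ℝ) * |g j| * ((X σ j : ℤ) : ℝ) + ∑ j, (((-σ) j : ℤ) : ℝ) * |g j| * ((X (-σ) j : ℤ) : ℝ)) / 2 ≤
        FF m n A K (fun j => ((σ j : ℤ) : ℝ) * |g j|) := by
      intro σ
      refine le_trans (le_of_eq ?_) (le_ff _ (hmem σ))
      rw [← Finset.sum_add_distrib, Finset.sum_div]
      refine Finset.sum_congr rfl fun j _ => ?_
      simp only [Pi.neg_apply, Units.val_neg, Int.cast_neg]; ring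
    refine le_trans (le_of_eq ?_) (Finset.sum_le_sum fun σ _ => h1 σ)
    have hneg : ∑ σ : Fin n → ℤˣ, ∑ j, (((-σ) j : ℤ) : ℝ) * |g j| * ((X (-σ) j : ℤ) : ℝ) =
        ∑ σ : Fin n → ℤˣ, ∑ j, ((σ j : ℤ) : ℝ) * |g j| * ((X σ j : ℤ) : ℝ) :=
      Equiv.sum_comp (Equiv.neg (Fin n → ℤˣ)) (fun σ => ∑ j, ((σ j : ℤ) : ℝ) * |g j| * ((X σ j : ℤ) : ℝ))
    rw [← Finset.sum_div, Finset.sum_add_distrib, hneg, add_self_div_two,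
      Finset.sum_comm]
    refine Finset.sum_congr rfl fun j _ => ?_
    rw [Finset.mul_sum]
    exact Finset.sum_congr rfl fun σ _ => by ring
  have hint := integral_mono (μ := gam n)
    (integrable_finsetSum Finset.univ fun j _ => (int_abs_coord j).mul_const (∑ σ : Fin n → ℤˣ, ((σ j : ℤ) : ℝ) * ((X σ j : ℤ) : ℝ)))
    (integrable_finsetSum Finset.univ fun σ _ => flip_int hK0 σ) hpt
  rw [integral_finsetSum _ fun j _ => (int_abs_coord j).mul_const _,
    integral_finsetSum _ fun σ _ => flip_int hK0 σ] at hint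
  simp_rw [flip_integral hK0, integral_mul_const, integral_abs_coord] at hint
  rw [← Finset.mul_sum, Finset.sum_comm] at hint
  simp only [Finset.sum_const, Finset.card_univ, card_cube, nsmul_eq_mul] at hint
  push_cast at hint
  have h2 := mul_le_mul_of_nonneg_left hw kap_nonneg
  have h3 : t^2/t = t := by field_simp
  rw [h3] at h2
  have h4 : (2:ℝ)^n * (n * kap * (1 - 2 * t)) ≤ 2^n * ∫ g, FF m n A K g ∂(gam n) := by
    refine le_trans (le_of_eq ?_) (h2.trans hint)
    ring
  exact le_of_mul_le_mul_left h4 (by positivity)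

/-- Averaged stability of `C ↦ OPT_A(C)`: there is an absolute constant `c > 0` such that for
every `δ ∈ (0,1]` there are `C₀ > 0` and `n₀` with the following property: for `0 ≤ ε ≤ c`,
`C ≥ C₀`, `n ≥ n₀`, and `C' ~ Unif[C, 2C]`, with probability at least `5/6` one has
`OPT_A(C' + Cε) - OPT_A(C') ≤ δ ε √n`. -/
theorem OPT_averaged_stability :
    ∃ c : ℝ, 0 < c ∧ ∀ δ : ℝ, 0 < δ → δ ≤ 1 →
      ∃ C₀ : ℝ, 0 < C₀ ∧ ∃ n₀ : ℕ,
        ∀ ε : ℝ, 0 ≤ ε → ε ≤ c → ∀ C : ℝ, C₀ ≤ C → ∀ n : ℕ, n₀ ≤ n → ∀ m : ℕ, 0 < m →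
          ∀ A : Matrix (Fin m) (Fin n) ℝ, (∀ i j, |A i j| ≤ 1) →
            (5 / 6 : ENNReal) ≤
              unifIcc C (2 * C)
                {C' : ℝ | OPT m n A (C' + C * ε) - OPT m n A C' ≤ δ * ε * Real.sqrt n} := by
  refine ⟨1, one_pos, fun δ hδ hδ1 => ?_⟩
  set t := δ / 4 with ht
  have htp : 0 < t := by positivity
  refine ⟨max 8 (96 / t^2), by positivity, max 1 ⌈2 / t^2⌉₊, ?_⟩
  intro ε hε _ C hC n hn m _ A hA
  have hC8 : 8 ≤ C := (le_max_left _ _).trans hC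
  have hC2 : 96 / t^2 ≤ C := (le_max_right _ _).trans hC
  have hn1 : 0 < n := (le_max_left _ _).trans hn
  have hn2 : 2 / t^2 ≤ (n:ℝ) := Nat.ceil_le.1 ((le_max_right _ _).trans hn)
  have hn' : (0:ℝ) < n := by exact_mod_cast hn1
  have hlow := ff_integral_lower m n hn1 A hA (C/2) t htp (by linarith)
    (by have : 48 / t^2 = 96 / t^2 / 2 := by ring
        linarith) hn2
  have hsub : Set.Icc C (2 * C) ⊆
      {C' : ℝ | OPT m n A (C' + C * ε) - OPT m n A C' ≤ δ * ε * Real.sqrt n} := by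
    intro C' hC'
    have hC'1 := hC'.1
    have hCε : 0 ≤ C * ε := by positivity
    have hD : 0 < C' + C * ε - C / 2 := by linarith
    set l := C * ε / (C' + C * ε - C / 2) with hl
    have hl0 : 0 ≤ l := by positivity
    have hl1 : l ≤ 1 := by rw [hl, div_le_one hD]; linarith
    have hl2 : l ≤ 2 * ε := by rw [hl, div_le_iff₀ hD]; nlinarith
    have hcomb : l * (C / 2) + (1 - l) * (C' + C * ε) = C' := by
      have : l * (C' + C * ε - C / 2) = C * ε := by rw [hl]; exact div_mul_cancel₀ _ hD.ne'
      linarith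
    have h0 : 0 ≤ C / 2 := by linarith
    have h1 : 0 ≤ C' + C * ε := by linarith
    have h2 : 0 ≤ C' := by linarith
    have hconc : l * ∫ g, FF m n A (C/2) g ∂(gam n) + (1 - l) * ∫ g, FF m n A (C' + C * ε) g ∂(gam n) ≤
        ∫ g, FF m n A C' g ∂(gam n) := by
      rw [← integral_const_mul, ← integral_const_mul, ← integral_add ((ff_int h0).const_mul _) ((ff_int h1).const_mul _)]
      refine integral_mono (((ff_int h0).const_mul _).add ((ff_int h1).const_mul _)) (ff_int h2) fun g => ?_
      have := ff_concave (A := A) h0 h1 hl0 hl1 g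
      rw [hcomb] at this
      exact this
    have hup := ff_integral_upper (A := A) h1
    have hmain : ∫ g, FF m n A (C' + C * ε) g ∂(gam n) - ∫ g, FF m n A C' g ∂(gam n) ≤ δ * ε * n := by
      have h3 : ∫ g, FF m n A (C' + C * ε) g ∂(gam n) - ∫ g, FF m n A (C/2) g ∂(gam n) ≤ n * (2 * t) := by
        have : n * kap * (2 * t) ≤ n * 1 * (2 * t) := by gcongr; exact kap_le
        linarith
      have h4 := mul_le_mul_of_nonneg_left h3 hl0
      have h5 := mul_le_mul_of_nonneg_right hl2 (by positivity : 0 ≤ n * (2 * t))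
      have h6 : 2 * ε * (n * (2 * t)) = δ * ε * n := by rw [ht]; ring
      linarith
    show (∫ g, FF m n A (C' + C * ε) g ∂(gam n)) / Real.sqrt n - (∫ g, FF m n A C' g ∂(gam n)) / Real.sqrt n ≤ _
    rw [← sub_div, div_le_iff₀ (Real.sqrt_pos.2 hn'), mul_assoc, Real.mul_self_sqrt hn'.le]
    exact hmain
  refine le_trans ?_ (measure_mono hsub)
  have hvol : volume (Set.Icc C (2 * C)) = ENNReal.ofReal C := by
    rw [Real.volume_Icc]; congr 1; ring
  rw [unifIcc, Measure.smul_apply, Measure.restrict_apply_self, smul_eq_mul,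
    ENNReal.inv_mul_cancel]
  · exact ENNReal.div_le_of_le_mul (by norm_num)
  · rw [hvol]; simp; linarith
  · rw [hvol]; simp
end

section
/- Let m, n be positive integers, A ∈ ℝ^{m×n} with ‖A‖_{1→∞} ≤ 1, C > 0, and η ∈ (0, 1/100]. Suppose that for every subset S ⊆ [n] with |S| ≥ (1−η)n, E_{g~N(0,I_n)}[ sup { ⟨g,y⟩ : y ∈ Γ_{A,C}, y_j = 0 for all j ∉ S } ] ≥ n/2. Then, for g ~ N(0,I_n), with probability at least 1 − (n choose ⌊ηn⌋)·2·exp(−n/32), simultaneously for every subset S ⊆ [n] with |S| ≥ (1−η)n there exists y ∈ Γ_{A,C} with y_j = 0 for all j ∉ S and ⟨g,y⟩ ≥ n/4. -/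
open MeasureTheory ProbabilityTheory

namespace RSC

lemma cov_le (μ : Measure ℝ) [IsProbabilityMeasure μ] (a b c d : ℝ → ℝ)
    (ha : Integrable a μ) (hb : Integrable b μ) (hab : Integrable (fun x => a x * b x) μ)
    (hc : Integrable c μ) (hd : Integrable d μ) (hcd : Integrable (fun x => c x * d x) μ)
    (h : ∀ x y, (a x - a y) * (b x - b y) ≤ (c x - c y) * (d x - d y)) :
    (∫ x, a x * b x ∂μ) - (∫ x, a x ∂μ) * (∫ x, b x ∂μ) ≤
      (∫ x, c x * d x ∂μ) - (∫ x, c x ∂μ) * (∫ x, d x ∂μ) := by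
  have inn : ∀ a b : ℝ → ℝ, Integrable a μ → Integrable b μ →
      Integrable (fun x => a x * b x) μ → ∀ x,
      Integrable (fun y => (a x - a y) * (b x - b y)) μ ∧
      ∫ y, (a x - a y) * (b x - b y) ∂μ =
        a x * b x - a x * (∫ y, b y ∂μ) - b x * (∫ y, a y ∂μ) + ∫ y, a y * b y ∂μ := by
    intro a b ha hb hab x
    have e : (fun y => (a x - a y) * (b x - b y)) =
        fun y => ((a x * b x - a x * b y) - b x * a y) + a y * b y := by
      ext y; ring
    rw [e]
    have i1 : Integrable (fun y => a x * b x - a x * b y) μ :=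
      (integrable_const _).sub (hb.const_mul _)
    have i2 : Integrable (fun y => (a x * b x - a x * b y) - b x * a y) μ :=
      i1.sub (ha.const_mul _)
    refine ⟨i2.add hab, ?_⟩
    rw [integral_add i2 hab, integral_sub i1 (ha.const_mul _),
      integral_sub (integrable_const _) (hb.const_mul _), integral_const_mul (a x) b,
      integral_const_mul (b x) a]
    simp
  have out : ∀ a b : ℝ → ℝ, Integrable a μ → Integrable b μ →
      Integrable (fun x => a x * b x) μ →
      Integrable (fun x => a x * b x - a x * (∫ y, b y ∂μ) - b x * (∫ y, a y ∂μ)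
        + ∫ y, a y * b y ∂μ) μ ∧
      ∫ x, (a x * b x - a x * (∫ y, b y ∂μ) - b x * (∫ y, a y ∂μ) + ∫ y, a y * b y ∂μ) ∂μ =
        2 * ((∫ x, a x * b x ∂μ) - (∫ x, a x ∂μ) * (∫ x, b x ∂μ)) := by
    intro a b ha hb hab
    have i1 : Integrable (fun x => a x * b x - a x * (∫ y, b y ∂μ)) μ :=
      hab.sub (ha.mul_const _)
    have i2 : Integrable (fun x => a x * b x - a x * (∫ y, b y ∂μ) - b x * (∫ y, a y ∂μ)) μ :=
      i1.sub (hb.mul_const _)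
    refine ⟨i2.add (integrable_const _), ?_⟩
    rw [integral_add i2 (integrable_const _), integral_sub i1 (hb.mul_const _),
      integral_sub hab (ha.mul_const _), integral_mul_const, integral_mul_const]
    simp
    ring
  have key := integral_mono (out a b ha hb hab).1 (out c d hc hd hcd).1 (fun x => by
    have := integral_mono (inn a b ha hb hab x).1 (inn c d hc hd hcd x).1 (fun y => h x y)
    rw [(inn a b ha hb hab x).2, (inn c d hc hd hcd x).2] at this
    exact this)
  rw [(out a b ha hb hab).2, (out c d hc hd hcd).2] at key
  linarith

lemma integrable_exp_abs (c : ℝ) :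
    Integrable (fun x : ℝ => Real.exp (c * |x|)) (gaussianReal 0 1) :=
  integrable_exp_mul_abs (integrable_exp_mul_gaussianReal c) (integrable_exp_mul_gaussianReal (-c))

lemma integrable_growth {f : ℝ → ℝ} (hf : Continuous f) (K c : ℝ)
    (h : ∀ x, |f x| ≤ K * Real.exp (c * |x|)) : Integrable f (gaussianReal 0 1) :=
  ((integrable_exp_abs c).const_mul K).mono' hf.aestronglyMeasurable
    (Filter.Eventually.of_forall h)

lemma integrable_pdf {f : ℝ → ℝ} (hf : Integrable f (gaussianReal 0 1)) :
    Integrable (fun x => gaussianPDFReal 0 1 x * f x) := by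
  rw [gaussianReal_of_var_ne_zero 0 one_ne_zero,
    integrable_withDensity_iff_integrable_smul' (measurable_gaussianPDF 0 1)
      (Filter.Eventually.of_forall fun x => gaussianPDF_lt_top)] at hf
  simpa using hf

lemma stein (G g : ℝ → ℝ) (hG : ∀ x, HasDerivAt G (g x) x)
    (i0 : Integrable G (gaussianReal 0 1)) (i1 : Integrable g (gaussianReal 0 1))
    (i2 : Integrable (fun x => x * G x) (gaussianReal 0 1)) :
    ∫ x, x * G x ∂(gaussianReal 0 1) = ∫ x, g x ∂(gaussianReal 0 1) := by
  have hv : ∀ x, HasDerivAt (gaussianPDFReal 0 1) (-x * gaussianPDFReal 0 1 x) x := by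
    intro x
    have : HasDerivAt (fun x : ℝ => (Real.sqrt (2 * Real.pi * (1 : NNReal)))⁻¹ *
        Real.exp (-(x - 0) ^ 2 / (2 * (1 : NNReal)))) (-x * gaussianPDFReal 0 1 x) x := by
      have h1 : HasDerivAt (fun x : ℝ => -(x - 0) ^ 2 / (2 * ((1 : NNReal) : ℝ))) (-x) x := by
        have := (((hasDerivAt_id x).sub_const 0).pow 2).neg.div_const (2 * ((1 : NNReal) : ℝ))
        refine this.congr_deriv ?_
        simp
        ring
      refine (h1.exp.const_mul _).congr_deriv ?_
      rw [gaussianPDFReal]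
      ring
    exact this
  rw [integral_gaussianReal_eq_integral_smul one_ne_zero,
    integral_gaussianReal_eq_integral_smul one_ne_zero]
  have := integral_mul_deriv_eq_deriv_mul_of_integrable (u := G) (u' := g)
    (v := gaussianPDFReal 0 1) (v' := fun x => -x * gaussianPDFReal 0 1 x)
    (fun x _ => hG x) (fun x _ => hv x)
    ((integrable_pdf i2).neg.congr (Filter.Eventually.of_forall fun x => by
      simp only [Pi.neg_apply, Pi.mul_apply]; ring))
    ((integrable_pdf i1).congr (Filter.Eventually.of_forall fun x => by
      simp only [Pi.mul_apply]; ring))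
    ((integrable_pdf i0).congr (Filter.Eventually.of_forall fun x => by
      simp only [Pi.mul_apply]; ring))
  have e1 : ∫ x, gaussianPDFReal 0 1 x • (x * G x) =
      - ∫ x, G x * (-x * gaussianPDFReal 0 1 x) := by
    rw [← integral_neg]; congr 1; ext x; simp only [smul_eq_mul]; ring
  rw [e1, this, neg_neg]
  congr 1; ext x; simp only [smul_eq_mul]; ring

lemma exp_diff_le (h : ℝ → ℝ) (hh : ∀ x y, |h x - h y| ≤ |x - y|) (hc : Continuous h)
    (l : ℝ) (hl : 0 ≤ l) {x y : ℝ} (hxy : x ≤ y) :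
    Real.exp (l * h y) - Real.exp (l * h x) ≤ l * ∫ t in x..y, Real.exp (l * h t) := by
  have h1 : ∫ t in x..y, l * Real.exp (l * (h y - y + t)) ≤
      ∫ t in x..y, l * Real.exp (l * h t) := by
    apply intervalIntegral.integral_mono_on hxy
    · exact Continuous.intervalIntegrable (by fun_prop) _ _
    · exact Continuous.intervalIntegrable (by fun_prop) _ _
    · intro t ht
      have := hh y t
      rw [abs_of_nonneg (sub_nonneg.2 ht.2)] at this
      have := (abs_le.1 this).2
      gcongr
      linarith
  have h2 : ∫ t in x..y, l * Real.exp (l * (h y - y + t)) =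
      Real.exp (l * (h y - y + y)) - Real.exp (l * (h y - y + x)) := by
    apply intervalIntegral.integral_eq_sub_of_hasDerivAt
      (f := fun t => Real.exp (l * (h y - y + t)))
    · intro t _
      have := (((hasDerivAt_id t).const_add (h y - y)).const_mul l).exp
      refine this.congr_deriv ?_
      simp; ring
    · exact Continuous.intervalIntegrable (by fun_prop) _ _
  have h3 : Real.exp (l * (h y - y + x)) ≤ Real.exp (l * h x) := by
    have := hh y x
    rw [abs_of_nonneg (sub_nonneg.2 hxy)] at this
    have := (abs_le.1 this).2
    gcongr
    linarith
  have h4 : h y - y + y = h y := by ring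
  rw [h4] at h2
  rw [← intervalIntegral.integral_const_mul]
  linarith

lemma exp_diff_le' (h : ℝ → ℝ) (hh : ∀ x y, |h x - h y| ≤ |x - y|) (hc : Continuous h)
    (l : ℝ) (hl : 0 ≤ l) {x y : ℝ} (hxy : x ≤ y) :
    Real.exp (l * h x) - Real.exp (l * h y) ≤ l * ∫ t in x..y, Real.exp (l * h t) := by
  have := exp_diff_le (fun t => h (-t)) (fun a b => by
    have := hh (-a) (-b)
    rwa [show -a - -b = -(a - b) by ring, abs_neg] at this) (by fun_prop) l hl (neg_le_neg hxy)
  rw [intervalIntegral.integral_comp_neg (fun t => Real.exp (l * h t))] at this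
  simpa using this

lemma lip_cont {h : ℝ → ℝ} (hh : ∀ x y, |h x - h y| ≤ |x - y|) : Continuous h := by
  have : LipschitzWith 1 h := LipschitzWith.of_dist_le_mul fun x y => by
    simpa [Real.dist_eq] using hh x y
  exact this.continuous

lemma abs_le_exp (x : ℝ) : |x| ≤ Real.exp |x| := by
  linarith [Real.add_one_le_exp |x|]

lemma exp_bound {h : ℝ → ℝ} (hh : ∀ x y, |h x - h y| ≤ |x - y|) (l : ℝ) (x : ℝ) :
    Real.exp (l * h x) ≤ Real.exp (|l| * |h 0|) * Real.exp (|l| * |x|) := by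
  rw [← Real.exp_add]
  gcongr
  have := hh x 0
  rw [sub_zero] at this
  have h2 : |h x| ≤ |h 0| + |x| := by
    have := abs_sub_abs_le_abs_sub (h x) (h 0); linarith
  calc l * h x ≤ |l * h x| := le_abs_self _
    _ = |l| * |h x| := abs_mul _ _
    _ ≤ |l| * (|h 0| + |x|) := by gcongr
    _ = _ := by ring

lemma integrable_exp_lip {h : ℝ → ℝ} (hh : ∀ x y, |h x - h y| ≤ |x - y|) (l : ℝ) :
    Integrable (fun x => Real.exp (l * h x)) (gaussianReal 0 1) := by
  have := lip_cont hh
  refine integrable_growth (by fun_prop) (Real.exp (|l| * |h 0|)) |l| fun x => ?_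
  rw [abs_of_pos (Real.exp_pos _)]
  exact exp_bound hh l x

lemma cov_bound {h : ℝ → ℝ} (hh : ∀ x y, |h x - h y| ≤ |x - y|) (l : ℝ) (hl : 0 ≤ l)
    (i1 : Integrable h (gaussianReal 0 1))
    (i2 : Integrable (fun x => h x * Real.exp (l * h x)) (gaussianReal 0 1)) :
    (∫ x, h x * Real.exp (l * h x) ∂(gaussianReal 0 1)) ≤
      ((∫ x, h x ∂(gaussianReal 0 1)) + l) * ∫ x, Real.exp (l * h x) ∂(gaussianReal 0 1) := by
  have hc := lip_cont hh
  set G : ℝ → ℝ := fun x => ∫ t in (0:ℝ)..x, Real.exp (l * h t) with hG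
  have hd : ∀ x, HasDerivAt G (Real.exp (l * h x)) x := fun x =>
    intervalIntegral.integral_hasDerivAt_right
      (Continuous.intervalIntegrable (by fun_prop) _ _)
      (Continuous.stronglyMeasurableAtFilter (by fun_prop) _ _)
      (Continuous.continuousAt (by fun_prop))
  have hGc : Continuous G := continuous_iff_continuousAt.2 fun x => (hd x).continuousAt
  have hGb : ∀ x, |G x| ≤ Real.exp (l * |h 0|) * Real.exp (l * |x|) * |x| := by
    intro x
    have := intervalIntegral.norm_integral_le_of_norm_le_const (a := 0) (b := x)
      (f := fun t => Real.exp (l * h t)) (C := Real.exp (l * |h 0|) * Real.exp (l * |x|)) (by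
        intro t ht
        rw [Real.norm_eq_abs, abs_of_pos (Real.exp_pos _)]
        have h1 := exp_bound hh l t
        rw [abs_of_nonneg hl] at h1
        refine h1.trans ?_
        have : |t| ≤ |x| := by
          rcases Set.mem_uIoc.1 ht with h | h
          · rw [abs_of_pos h.1]; exact h.2.trans (le_abs_self _)
          · rw [abs_of_nonpos h.2, abs_of_neg (h.1.trans_le h.2)]; linarith [h.1]
        gcongr)
    simpa using this
  have hGb1 : ∀ x, |G x| ≤ Real.exp (l * |h 0|) * Real.exp ((l + 1) * |x|) := by
    intro x
    refine (hGb x).trans ?_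
    rw [add_mul, Real.exp_add, one_mul, mul_assoc]
    gcongr
    exact abs_le_exp x
  have hGb2 : ∀ x, |x * G x| ≤ Real.exp (l * |h 0|) * Real.exp ((l + 2) * |x|) := by
    intro x
    rw [abs_mul]
    calc |x| * |G x| ≤ Real.exp |x| * (Real.exp (l * |h 0|) * Real.exp ((l + 1) * |x|)) := by
          gcongr
          · exact abs_le_exp x
          · exact hGb1 x
      _ = _ := by rw [← Real.exp_add, ← Real.exp_add, ← Real.exp_add]; ring_nf
  have j0 := integrable_growth hGc _ _ hGb1
  have j1 := integrable_growth (f := fun x => x * G x) (by fun_prop) _ _ hGb2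
  have jx : Integrable (fun x : ℝ => x) (gaussianReal 0 1) :=
    integrable_growth continuous_id 1 1 fun x => by simpa using abs_le_exp x
  have je := integrable_exp_lip hh l
  have ord : ∀ x y, x ≤ y → (h x - h y) * (Real.exp (l * h x) - Real.exp (l * h y)) ≤
      (x - y) * (l * G x - l * G y) := by
    intro x y hxy
    have e1 := exp_diff_le h hh hc l hl hxy
    have e2 := exp_diff_le' h hh hc l hl hxy
    have e3 : ∫ t in x..y, Real.exp (l * h t) = G y - G x := by
      rw [hG]
      simp only
      rw [intervalIntegral.integral_interval_sub_left] <;>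
        exact Continuous.intervalIntegrable (by fun_prop) _ _
    rw [e3] at e1 e2
    calc _ ≤ |(h x - h y) * (Real.exp (l * h x) - Real.exp (l * h y))| := le_abs_self _
      _ = |h x - h y| * |Real.exp (l * h x) - Real.exp (l * h y)| := abs_mul _ _
      _ ≤ |x - y| * (l * (G y - G x)) := by
        refine mul_le_mul (hh x y) ?_ (abs_nonneg _) (abs_nonneg _)
        rw [abs_le]; constructor <;> linarith
      _ = _ := by rw [abs_of_nonpos (sub_nonpos.2 hxy)]; ring
  have jl : Integrable (fun x => x * (l * G x)) (gaussianReal 0 1) :=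
    (j1.const_mul l).congr (Filter.Eventually.of_forall fun x => by simp only; ring)
  have key := cov_le (gaussianReal 0 1) h (fun x => Real.exp (l * h x)) (fun x => x)
    (fun x => l * G x) i1 je i2 jx (j0.const_mul l) jl (by
      intro x y
      rcases le_total x y with hxy | hxy
      · exact ord x y hxy
      · have := ord y x hxy
        linarith)
  have e4 : ∫ x, x * (l * G x) ∂(gaussianReal 0 1) =
      l * ∫ x, Real.exp (l * h x) ∂(gaussianReal 0 1) := by
    rw [← stein G _ hd j0 je j1, ← integral_const_mul]
    congr 1; ext x; ring
  rw [e4, integral_id_gaussianReal] at key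
  linarith

lemma mgf_one_pos {h : ℝ → ℝ} (hh : ∀ x y, |h x - h y| ≤ |x - y|) (l : ℝ) (hl : 0 ≤ l) :
    ∫ x, Real.exp (l * h x) ∂(gaussianReal 0 1) ≤
      Real.exp (l * (∫ x, h x ∂(gaussianReal 0 1)) + l ^ 2 / 2) := by
  set E := ∫ x, h x ∂(gaussianReal 0 1) with hE
  have huniv : integrableExpSet h (gaussianReal 0 1) = Set.univ :=
    Set.eq_univ_of_forall fun t => integrable_exp_lip hh t
  have hint : ∀ t, t ∈ interior (integrableExpSet h (gaussianReal 0 1)) := by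
    intro t; rw [huniv]; simp
  have hd := fun t => hasDerivAt_mgf (hint t)
  have hd2 : ∀ t, HasDerivAt (fun t => mgf h (gaussianReal 0 1) t * Real.exp (-(t * E + t ^ 2 / 2)))
      (((∫ x, h x * Real.exp (t * h x) ∂(gaussianReal 0 1)) -
        (E + t) * mgf h (gaussianReal 0 1) t) * Real.exp (-(t * E + t ^ 2 / 2))) t := by
    intro t
    have h1 : HasDerivAt (fun t : ℝ => -(t * E + t ^ 2 / 2)) (-(E + t)) t := by
      have := (((hasDerivAt_id t).mul_const E).add (((hasDerivAt_id t).pow 2).div_const 2)).neg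
      refine this.congr_deriv ?_
      simp
    refine ((hd t).mul h1.exp).congr_deriv ?_
    ring
  have hi1 : Integrable h (gaussianReal 0 1) := integrable_of_mem_interior_integrableExpSet (hint 0)
  have anti : AntitoneOn (fun t => mgf h (gaussianReal 0 1) t * Real.exp (-(t * E + t ^ 2 / 2)))
      (Set.Ici 0) := by
    apply antitoneOn_of_deriv_nonpos (convex_Ici 0)
    · exact fun t _ => (hd2 t).continuousAt.continuousWithinAt
    · exact fun t _ => (hd2 t).differentiableAt.differentiableWithinAt
    · intro t ht
      rw [(hd2 t).deriv]
      have ht0 : 0 ≤ t := by simpa using interior_subset ht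
      have := cov_bound hh t ht0 hi1 (by
        simpa using integrable_pow_mul_exp_of_mem_interior_integrableExpSet (hint t) 1)
      apply mul_nonpos_of_nonpos_of_nonneg _ (Real.exp_pos _).le
      rw [mgf]
      linarith
  have := anti (Set.mem_Ici.2 le_rfl) (Set.mem_Ici.2 hl) hl
  simp only [mgf_zero, zero_mul] at this
  rw [Real.exp_neg, ← div_eq_mul_inv, div_le_iff₀ (Real.exp_pos _)] at this
  simpa [mgf] using this

lemma mgf_one {h : ℝ → ℝ} (hh : ∀ x y, |h x - h y| ≤ |x - y|) (l : ℝ) :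
    ∫ x, Real.exp (l * h x) ∂(gaussianReal 0 1) ≤
      Real.exp (l * (∫ x, h x ∂(gaussianReal 0 1)) + l ^ 2 / 2) := by
  rcases le_total 0 l with hl | hl
  · exact mgf_one_pos hh l hl
  · have := mgf_one_pos (h := fun x => - h x) (fun x y => by
      have := hh x y
      rwa [show -h x - -h y = -(h x - h y) by ring, abs_neg]) (-l) (by linarith)
    simpa [integral_neg] using this

lemma lip_cont_n {n : ℕ} {F : (Fin n → ℝ) → ℝ} (hF : ∀ x y, |F x - F y| ≤ ∑ i, |x i - y i|) :
    Continuous F := by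
  have : LipschitzWith n F := LipschitzWith.of_dist_le_mul fun x y => by
    rw [Real.dist_eq]
    refine (hF x y).trans ?_
    calc ∑ i, |x i - y i| ≤ ∑ _i : Fin n, dist x y :=
          Finset.sum_le_sum fun i _ => by
            rw [← Real.dist_eq]; exact dist_le_pi_dist x y i
      _ = _ := by simp
  exact this.continuous

lemma integrable_exp_n {n : ℕ} {F : (Fin n → ℝ) → ℝ}
    (hF : ∀ x y, |F x - F y| ≤ ∑ i, |x i - y i|) (l : ℝ) :
    Integrable (fun x => Real.exp (l * F x)) (Measure.pi fun _ : Fin n => gaussianReal 0 1) := by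
  have hc := lip_cont_n hF
  have h1 : Integrable (fun x : Fin n → ℝ => ∏ i, Real.exp (|l| * |x i|))
      (Measure.pi fun _ : Fin n => gaussianReal 0 1) :=
    Integrable.fintype_prod (f := fun _ t => Real.exp (|l| * |t|))
      (fun _ => integrable_exp_abs |l|)
  refine (h1.const_mul (Real.exp (|l| * |F 0|))).mono'
    (Continuous.aestronglyMeasurable (by fun_prop)) (Filter.Eventually.of_forall fun x => ?_)
  rw [Real.norm_eq_abs, abs_of_pos (Real.exp_pos _), ← Real.exp_sum, ← Real.exp_add,
    ← Finset.mul_sum]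
  gcongr
  have := hF x 0
  simp only [Pi.zero_apply, sub_zero] at this
  have h2 : |F x| ≤ |F 0| + ∑ i, |x i| := by
    have := abs_sub_abs_le_abs_sub (F x) (F 0); linarith
  calc l * F x ≤ |l * F x| := le_abs_self _
    _ = |l| * |F x| := abs_mul _ _
    _ ≤ |l| * (|F 0| + ∑ i, |x i|) := by gcongr
    _ = _ := by ring

lemma integrable_n {n : ℕ} {F : (Fin n → ℝ) → ℝ}
    (hF : ∀ x y, |F x - F y| ≤ ∑ i, |x i - y i|) :
    Integrable F (Measure.pi fun _ : Fin n => gaussianReal 0 1) := by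
  have hc := lip_cont_n hF
  refine ((integrable_exp_n hF 1).add (integrable_exp_n hF (-1))).mono'
    hc.aestronglyMeasurable (Filter.Eventually.of_forall fun x => ?_)
  simp only [Pi.add_apply, Real.norm_eq_abs, one_mul, neg_mul]
  rw [abs_le]
  constructor <;>
  linarith [Real.add_one_le_exp (F x), Real.add_one_le_exp (-F x), Real.exp_pos (F x),
    Real.exp_pos (-F x)]

lemma mgf_n : ∀ (n : ℕ) (F : (Fin n → ℝ) → ℝ)
    (_ : ∀ x y, |F x - F y| ≤ ∑ i, |x i - y i|) (l : ℝ),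
    ∫ x, Real.exp (l * F x) ∂(Measure.pi fun _ : Fin n => gaussianReal 0 1) ≤
      Real.exp (l * (∫ x, F x ∂(Measure.pi fun _ : Fin n => gaussianReal 0 1))
        + n * (l ^ 2 / 2)) := by
  intro n
  induction n with
  | zero =>
    intro F hF l
    have : ∀ x, F x = F 0 := fun x => by rw [Subsingleton.elim x 0]
    simp [this]
  | succ n ih =>
    intro F hF l
    have mp := (measurePreserving_piFinSuccAbove
      (fun _ : Fin (n + 1) => gaussianReal 0 1) 0).symm
    have tr : ∀ f : (Fin (n + 1) → ℝ) → ℝ,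
        Integrable f (Measure.pi fun _ : Fin (n + 1) => gaussianReal 0 1) →
        Integrable (fun z : ℝ × (Fin n → ℝ) => f (Fin.cons z.1 z.2))
          ((gaussianReal 0 1).prod (Measure.pi fun _ : Fin n => gaussianReal 0 1)) ∧
        ∫ x, f x ∂(Measure.pi fun _ : Fin (n + 1) => gaussianReal 0 1) =
          ∫ a, ∫ y, f (Fin.cons a y) ∂(Measure.pi fun _ : Fin n => gaussianReal 0 1)
            ∂(gaussianReal 0 1) := by
      intro f hf
      have e : ∀ z : ℝ × (Fin n → ℝ),
          (MeasurableEquiv.piFinSuccAbove (fun _ : Fin (n + 1) => ℝ) 0).symm z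
            = (Fin.cons z.1 z.2 : Fin (n + 1) → ℝ) := by
        intro z
        simp [MeasurableEquiv.piFinSuccAbove_symm_apply, Fin.insertNthEquiv]
      have i1 : Integrable (fun z : ℝ × (Fin n → ℝ) => f (Fin.cons z.1 z.2))
          ((gaussianReal 0 1).prod (Measure.pi fun _ : Fin n => gaussianReal 0 1)) := by
        have := (mp.integrable_comp_emb (MeasurableEquiv.measurableEmbedding _)).2 hf
        simpa only [Function.comp_def, e] using this
      refine ⟨i1, ?_⟩
      rw [← mp.integral_comp (MeasurableEquiv.measurableEmbedding _)]
      simp only [e]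
      exact integral_prod _ i1
    have hsec : ∀ a : ℝ, ∀ x y : Fin n → ℝ,
        |F (Fin.cons a x) - F (Fin.cons a y)| ≤ ∑ i, |x i - y i| := by
      intro a x y
      have := hF (Fin.cons a x) (Fin.cons a y)
      simpa [Fin.sum_univ_succ] using this
    set H : ℝ → ℝ := fun a => ∫ y, F (Fin.cons a y)
      ∂(Measure.pi fun _ : Fin n => gaussianReal 0 1) with hH
    have hHl : ∀ a b, |H a - H b| ≤ |a - b| := by
      intro a b
      rw [hH]
      simp only
      rw [← integral_sub (integrable_n (hsec a)) (integrable_n (hsec b))]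
      have := norm_integral_le_of_norm_le_const
        (μ := Measure.pi fun _ : Fin n => gaussianReal 0 1)
        (f := fun y => F (Fin.cons a y) - F (Fin.cons b y)) (C := |a - b|)
        (Filter.Eventually.of_forall fun y => by
          have := hF (Fin.cons a y) (Fin.cons b y)
          simpa [Fin.sum_univ_succ] using this)
      simpa using this
    have t1 := tr _ (integrable_exp_n hF l)
    rw [t1.2, (tr _ (integrable_n hF)).2]
    calc _ ≤ ∫ a, Real.exp (l * H a) * Real.exp (n * (l ^ 2 / 2)) ∂(gaussianReal 0 1) := by
          apply integral_mono t1.1.integral_prod_left ((integrable_exp_lip hHl l).mul_const _)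
          intro a
          have := ih (fun y => F (Fin.cons a y)) (hsec a) l
          rw [Real.exp_add] at this
          exact this
      _ = (∫ a, Real.exp (l * H a) ∂(gaussianReal 0 1)) * Real.exp (n * (l ^ 2 / 2)) :=
          integral_mul_const _ _
      _ ≤ Real.exp (l * (∫ a, H a ∂(gaussianReal 0 1)) + l ^ 2 / 2)
          * Real.exp (n * (l ^ 2 / 2)) := by
          gcongr
          exact mgf_one hHl l
      _ = _ := by
          rw [← Real.exp_add]
          congr 1
          push_cast
          ring

lemma lower_tail {n : ℕ} {F : (Fin n → ℝ) → ℝ}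
    (hF : ∀ x y, |F x - F y| ≤ ∑ i, |x i - y i|)
    (hE : (n : ℝ) / 2 ≤ ∫ x, F x ∂(Measure.pi fun _ : Fin n => gaussianReal 0 1)) :
    (Measure.pi fun _ : Fin n => gaussianReal 0 1) {x | F x ≤ n / 4} ≤
      ENNReal.ofReal (Real.exp (-(n : ℝ) / 32)) := by
  set μ := Measure.pi fun _ : Fin n => gaussianReal 0 1 with hμ
  have h1 := measure_le_le_exp_mul_mgf (X := F) (μ := μ) (t := -1/4) ((n : ℝ) / 4) (by norm_num)
    (integrable_exp_n hF _)
  have h2 := mgf_n n F hF (-1/4)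
  rw [← ofReal_measureReal]
  apply ENNReal.ofReal_le_ofReal
  refine h1.trans ?_
  rw [mgf]
  calc _ ≤ Real.exp (-(-1/4) * (n / 4)) *
        Real.exp ((-1/4) * (∫ x, F x ∂μ) + n * ((-1/4) ^ 2 / 2)) := by gcongr
    _ = Real.exp (-(-1/4) * (n / 4) + ((-1/4) * (∫ x, F x ∂μ) + n * ((-1/4) ^ 2 / 2))) := by
      rw [← Real.exp_add]
    _ ≤ _ := by
      gcongr
      linarith

lemma sup_props (m n : ℕ) (A : Matrix (Fin m) (Fin n) ℝ) (C : ℝ) (hC : 0 < C)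
    (S : Finset (Fin n)) (g : Fin n → ℝ) :
    (0 : ℝ) ∈ {t | ∃ y ∈ Gamma m n A C, (∀ j ∉ S, y j = 0) ∧ t = ∑ j, g j * y j} ∧
    BddAbove {t | ∃ y ∈ Gamma m n A C, (∀ j ∉ S, y j = 0) ∧ t = ∑ j, g j * y j} := by
  constructor
  · refine ⟨0, ⟨by simp, fun i => ?_⟩, by simp, by simp⟩
    simp only [Matrix.mulVec_zero, Pi.zero_apply, abs_zero]
    positivity
  · refine ⟨∑ j, |g j|, ?_⟩
    rintro t ⟨y, hy, -, rfl⟩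
    refine Finset.sum_le_sum fun j _ => ?_
    calc g j * y j ≤ |g j * y j| := le_abs_self _
      _ = |g j| * |y j| := abs_mul _ _
      _ ≤ |g j| * 1 := by gcongr; exact hy.1 j
      _ = _ := mul_one _

lemma sup_lip (m n : ℕ) (A : Matrix (Fin m) (Fin n) ℝ) (C : ℝ) (hC : 0 < C)
    (S : Finset (Fin n)) (g g' : Fin n → ℝ) :
    |sSup {t | ∃ y ∈ Gamma m n A C, (∀ j ∉ S, y j = 0) ∧ t = ∑ j, g j * y j} -
      sSup {t | ∃ y ∈ Gamma m n A C, (∀ j ∉ S, y j = 0) ∧ t = ∑ j, g' j * y j}|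
      ≤ ∑ j, |g j - g' j| := by
  have one : ∀ g g' : Fin n → ℝ,
      sSup {t | ∃ y ∈ Gamma m n A C, (∀ j ∉ S, y j = 0) ∧ t = ∑ j, g j * y j} ≤
      sSup {t | ∃ y ∈ Gamma m n A C, (∀ j ∉ S, y j = 0) ∧ t = ∑ j, g' j * y j}
      + ∑ j, |g j - g' j| := by
    intro g g'
    apply csSup_le ⟨0, (sup_props m n A C hC S g).1⟩
    rintro t ⟨y, hy, hy0, rfl⟩
    have h1 : ∑ j, g' j * y j ≤
        sSup {t | ∃ y ∈ Gamma m n A C, (∀ j ∉ S, y j = 0) ∧ t = ∑ j, g' j * y j} :=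
      le_csSup (sup_props m n A C hC S g').2 ⟨y, hy, hy0, rfl⟩
    have h2 : ∑ j, g j * y j ≤ ∑ j, g' j * y j + ∑ j, |g j - g' j| := by
      rw [← Finset.sum_add_distrib]
      refine Finset.sum_le_sum fun j _ => ?_
      have : (g j - g' j) * y j ≤ |g j - g' j| := by
        calc _ ≤ |(g j - g' j) * y j| := le_abs_self _
          _ = |g j - g' j| * |y j| := abs_mul _ _
          _ ≤ |g j - g' j| * 1 := by gcongr; exact hy.1 j
          _ = _ := mul_one _
      linarith
    linarith
  have h1 := one g g'
  have h2 := one g' g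
  have h3 : ∑ j, |g' j - g j| = ∑ j, |g j - g' j| :=
    Finset.sum_congr rfl fun j _ => abs_sub_comm _ _
  rw [abs_le]
  constructor <;> linarith

end RSC

theorem restricted_sup_concentration (m n : ℕ) (hm : 0 < m) (hn : 0 < n)
    (A : Matrix (Fin m) (Fin n) ℝ) (hA : ∀ i j, |A i j| ≤ 1) (C : ℝ) (hC : 0 < C)
    (η : ℝ) (hη : 0 < η) (hη' : η ≤ 1 / 100)
    (hyp : ∀ S : Finset (Fin n), (1 - η) * n ≤ (S.card : ℝ) →
      (n : ℝ) / 2 ≤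
        ∫ g, sSup {t | ∃ y ∈ Gamma m n A C, (∀ j ∉ S, y j = 0) ∧ t = ∑ j, g j * y j}
          ∂(Measure.pi fun _ : Fin n => gaussianReal 0 1)) :
    ENNReal.ofReal (1 - (n.choose ⌊η * n⌋₊ : ℝ) * 2 * Real.exp (-(n : ℝ) / 32)) ≤
      (Measure.pi fun _ : Fin n => gaussianReal 0 1)
        {g | ∀ S : Finset (Fin n), (1 - η) * n ≤ (S.card : ℝ) →
          ∃ y ∈ Gamma m n A C, (∀ j ∉ S, y j = 0) ∧ (n : ℝ) / 4 ≤ ∑ j, g j * y j} := by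
  classical
  set μ := Measure.pi fun _ : Fin n => gaussianReal 0 1 with hμ
  set E := {g : Fin n → ℝ | ∀ S : Finset (Fin n), (1 - η) * n ≤ (S.card : ℝ) →
          ∃ y ∈ Gamma m n A C, (∀ j ∉ S, y j = 0) ∧ (n : ℝ) / 4 ≤ ∑ j, g j * y j} with hE
  set k := ⌊η * n⌋₊ with hk
  have hn' : (0 : ℝ) < n := by exact_mod_cast hn
  have hk1 : (k : ℝ) ≤ η * n := Nat.floor_le (by positivity)
  have hk2 : η * n < k + 1 := Nat.lt_floor_add_one _
  have hkn : k ≤ n := by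
    have : (k : ℝ) ≤ n := by nlinarith
    exact_mod_cast this
  set F : Finset (Fin n) → (Fin n → ℝ) → ℝ := fun S g =>
    sSup {t | ∃ y ∈ Gamma m n A C, (∀ j ∉ S, y j = 0) ∧ t = ∑ j, g j * y j} with hF
  set P := Finset.powersetCard (n - k) (Finset.univ : Finset (Fin n)) with hP
  have hsub : Eᶜ ⊆ ⋃ T ∈ P, {g | F T g ≤ n / 4} := by
    intro g hg
    simp only [hE, Set.mem_compl_iff, Set.mem_ofPred_eq, not_forall] at hg
    obtain ⟨S, hS, hno⟩ := hg
    have hcard : n - k ≤ S.card := by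
      have h1 : n < S.card + k + 1 := by
        have : (n : ℝ) < S.card + k + 1 := by linarith
        exact_mod_cast this
      omega
    obtain ⟨T, hTS, hT⟩ := Finset.exists_subset_card_eq hcard
    simp only [Set.mem_iUnion]
    refine ⟨T, Finset.mem_powersetCard.2 ⟨Finset.subset_univ _, hT⟩, ?_⟩
    by_contra hlt
    simp only [Set.mem_ofPred_eq, not_le] at hlt
    obtain ⟨t, ⟨y, hy, hy0, rfl⟩, hty⟩ :=
      exists_lt_of_lt_csSup ⟨0, (RSC.sup_props m n A C hC T g).1⟩ hlt
    exact hno ⟨y, hy, fun j hj => hy0 j fun h => hj (hTS h), hty.le⟩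
  have hbound : μ Eᶜ ≤ ENNReal.ofReal ((n.choose k : ℝ) * Real.exp (-(n : ℝ) / 32)) := by
    calc μ Eᶜ ≤ μ (⋃ T ∈ P, {g | F T g ≤ n / 4}) := measure_mono hsub
      _ ≤ ∑ T ∈ P, μ {g | F T g ≤ n / 4} := measure_biUnion_finset_le _ _
      _ ≤ ∑ _T ∈ P, ENNReal.ofReal (Real.exp (-(n : ℝ) / 32)) := by
        refine Finset.sum_le_sum fun T hT => ?_
        refine RSC.lower_tail (fun x y => RSC.sup_lip m n A C hC T x y) (hyp T ?_)
        rw [(Finset.mem_powersetCard.1 hT).2, Nat.cast_sub hkn]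
        linarith
      _ = _ := by
        rw [Finset.sum_const, hP, Finset.card_powersetCard, Finset.card_univ, Fintype.card_fin,
          Nat.choose_symm hkn, nsmul_eq_mul, ENNReal.ofReal_mul (by positivity),
          ENNReal.ofReal_natCast]
  have h1 : (1 : ENNReal) ≤ μ E + μ Eᶜ := by
    rw [← measure_univ (μ := μ), ← Set.union_compl_self E]
    exact measure_union_le _ _
  calc _ ≤ ENNReal.ofReal (1 - (n.choose k : ℝ) * Real.exp (-(n : ℝ) / 32)) := by
        apply ENNReal.ofReal_le_ofReal
        have : 0 ≤ (n.choose k : ℝ) * Real.exp (-(n : ℝ) / 32) := by positivity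
        linarith
    _ = 1 - ENNReal.ofReal ((n.choose k : ℝ) * Real.exp (-(n : ℝ) / 32)) := by
        rw [ENNReal.ofReal_sub _ (by positivity), ENNReal.ofReal_one]
    _ ≤ μ E := by
        rw [tsub_le_iff_right]
        exact h1.trans (by gcongr)
end
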